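/- arXiv:2304.05446 — 12 statements merged into one kernel-verified Lean document; each statement's English description precedes it below -/
import Mathlib

section
/- Let G be a finite group of order v, let g : Fin v → G be a bijection, and let D ⊆ G be a (v,k,λ) difference set. For n ≥ 2, define the n-cube C : (Fin n → Fin v) → ℤ by C(i) = 1 if g(i₁)·g(i₂)·⋯·g(iₙ) ∈ D and C(i) = 0 otherwise. Then C is an n-dimensional cube of symmetric (v,k,λ) designs: for any two distinct coordinate positions x ≠ y in Fin n and any fixed values of the remaining n−2 coordinates, the v × v matrix M(a,b) = C(i) with i_x = a, i_y = b and the other coordinates fixed satisfies M·Mᵀ = (k−λ)·I + λ·J. -/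
/-- The sum of the squared fiber sizes of `f` counts the pairs with equal image. -/
lemma sum_sq_card_fiber {α β : Type*} [DecidableEq β] [Fintype β] (s : Finset α) (f : α → β) :
    ∑ b, (s.filter (fun a => f a = b)).card ^ 2 =
      ((s ×ˢ s).filter (fun p => f p.1 = f p.2)).card := by
  rw [Finset.card_eq_sum_card_fiberwise (f := fun p => f p.1) (t := Finset.univ)
    (fun _ _ => by simp)]
  refine Finset.sum_congr rfl fun b _ => ?_
  rw [sq, ← Finset.card_product]
  congr 1
  ext ⟨p, q⟩
  simp only [Finset.mem_product, Finset.mem_filter]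
  grind

/-- If all nontrivial left quotients are represented equally often by a set, then so are all
nontrivial right quotients. -/
lemma card_right_quotient_of_card_left_quotient {G : Type*} [Group G] [Fintype G] [DecidableEq G]
    (D : Finset G) (l : ℕ)
    (hdiff : ∀ h : G, h ≠ 1 →
      ((D ×ˢ D).filter (fun p => p.1⁻¹ * p.2 = h)).card = l) (h : G) (hh : h ≠ 1) :
    ((D ×ˢ D).filter (fun p => p.1 * p.2⁻¹ = h)).card = l := by
  set L : G → ℕ := fun h => ((D ×ˢ D).filter (fun p => p.1⁻¹ * p.2 = h)).card with hL
  set R : G → ℕ := fun h => ((D ×ˢ D).filter (fun p => p.1 * p.2⁻¹ = h)).card with hR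
  have sum_eq : ∑ h, R h = ∑ h, L h := by
    rw [← Finset.card_eq_sum_card_fiberwise (fun _ _ => by simp),
      ← Finset.card_eq_sum_card_fiberwise (fun _ _ => by simp)]
  have sum_sq_eq : ∑ h, R h ^ 2 = ∑ h, L h ^ 2 := by
    rw [sum_sq_card_fiber, sum_sq_card_fiber]
    refine Finset.card_nbij' (fun p => ((p.2.1, p.1.1), (p.2.2, p.1.2)))
      (fun p => ((p.1.2, p.2.2), (p.1.1, p.2.1))) ?_ ?_ (fun _ _ => rfl) (fun _ _ => rfl)
    · rintro ⟨⟨a, b⟩, c, d⟩ hp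
      simp only [Finset.coe_filter, Finset.mem_product, Set.mem_ofPred_eq] at hp ⊢
      refine ⟨by tauto, ?_⟩
      rw [inv_mul_eq_iff_eq_mul, ← mul_assoc, ← hp.2, inv_mul_cancel_right]
    · rintro ⟨⟨a, b⟩, c, d⟩ hp
      simp only [Finset.coe_filter, Finset.mem_product, Set.mem_ofPred_eq] at hp ⊢
      refine ⟨by tauto, ?_⟩
      rw [mul_inv_eq_iff_eq_mul, mul_assoc, ← hp.2, mul_inv_cancel_left]
  have one_eq : R 1 = L 1 := by
    simp only [hR, hL, mul_inv_eq_one, inv_mul_eq_one]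
  have key : ∑ h, ((R h : ℤ) - L h) ^ 2 = 0 := by
    have cross : ∀ h, ((R h : ℤ) - L h) * L h = ((R h : ℤ) - L h) * l := by
      intro h
      by_cases h1 : h = 1
      · rw [h1, one_eq]; simp
      · rw [show L h = l from hdiff h h1]
    have expand : ∀ h, ((R h : ℤ) - L h) ^ 2 =
        (R h : ℤ) ^ 2 - (L h : ℤ) ^ 2 - 2 * l * (R h - L h) := by
      intro h
      linear_combination -2 * cross h
    have sum_eq' : ∑ h, (R h : ℤ) = ∑ h, (L h : ℤ) := by exact_mod_cast sum_eq
    have sum_sq_eq' : ∑ h, (R h : ℤ) ^ 2 = ∑ h, (L h : ℤ) ^ 2 := by exact_mod_cast sum_sq_eq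
    simp only [expand, Finset.sum_sub_distrib, ← Finset.mul_sum, sum_eq', sum_sq_eq']
    ring
  have hRL := (Finset.sum_eq_zero_iff_of_nonneg (fun _ _ => sq_nonneg _)).1 key h
    (Finset.mem_univ h)
  have hRL' : R h = L h := by
    exact_mod_cast sub_eq_zero.1 (pow_eq_zero_iff two_ne_zero |>.1 hRL)
  exact hRL'.trans (hdiff h hh)

/-- A product of a list, as a function of one of its entries. -/
lemma exists_prod_ofFn_eq {G : Type*} [Monoid G] {n : ℕ} (f : Fin n → G) (x : Fin n) :
    ∃ p r : G, ∀ a, (List.ofFn (fun t => if t = x then a else f t)).prod = p * a * r := by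
  induction n with
  | zero => exact x.elim0
  | succ n ih =>
    cases x using Fin.cases with
    | zero =>
      exact ⟨1, (List.ofFn (fun t : Fin n => f t.succ)).prod, fun a => by
        simp [List.ofFn_succ, Fin.succ_ne_zero]⟩
    | succ x =>
      obtain ⟨p, r, hpr⟩ := ih (fun t => f t.succ) x
      refine ⟨f 0 * p, r, fun a => ?_⟩
      simp [List.ofFn_succ, (Fin.succ_ne_zero _).symm, hpr, mul_assoc]

/-- A product of a list, as a function of two of its entries. -/
lemma exists_prod_ofFn_eq_of_lt {G : Type*} [Monoid G] {n : ℕ} (f : Fin n → G) (x y : Fin n)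
    (hxy : x < y) : ∃ p q r : G, ∀ a b,
      (List.ofFn (fun t => if t = x then a else if t = y then b else f t)).prod =
        p * a * q * b * r := by
  induction n with
  | zero => exact x.elim0
  | succ n ih =>
    cases y using Fin.cases with
    | zero => exact absurd hxy (Fin.not_lt_zero x)
    | succ y =>
      cases x using Fin.cases with
      | zero =>
        obtain ⟨p, r, hpr⟩ := exists_prod_ofFn_eq (fun t => f t.succ) y
        refine ⟨1, p, r, fun a b => ?_⟩
        simp [List.ofFn_succ, Fin.succ_ne_zero, hpr, mul_assoc]
      | succ x =>
        obtain ⟨p, q, r, h⟩ := ih (fun t => f t.succ) x y (Fin.succ_lt_succ_iff.1 hxy)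
        refine ⟨f 0 * p, q, r, fun a b => ?_⟩
        simp [List.ofFn_succ, (Fin.succ_ne_zero _).symm, h, mul_assoc]

/-- The number of indices `b` for which both `e b` and its translate by `c` on the left lie in `D`
is the number of representations of `c` as a right quotient. -/
lemma card_filter_mem_and_mul_left_mem {ι G : Type*} [Fintype ι] [Group G] [DecidableEq G]
    (D : Finset G) (e : ι ≃ G) (c : G) :
    (Finset.univ.filter (fun b => c * e b ∈ D ∧ e b ∈ D)).card =
      ((D ×ˢ D).filter (fun p => p.1 * p.2⁻¹ = c)).card := by
  refine Finset.card_nbij' (fun b => (c * e b, e b)) (fun p => e.symm p.2) ?_ ?_ ?_ ?_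
  · intro b hb; simpa using hb
  · rintro ⟨p, q⟩ hp
    simp only [Finset.coe_filter, Finset.mem_product, Set.mem_ofPred_eq] at hp
    obtain ⟨hp, rfl⟩ := hp
    simpa using hp
  · intro b _; simp
  · rintro ⟨p, q⟩ hp
    simp only [Finset.coe_filter, Finset.mem_product, Set.mem_ofPred_eq] at hp
    obtain ⟨hp, rfl⟩ := hp
    simp

/-- The number of indices `b` for which both `e b` and its translate by `c` on the right lie in `D`
is the number of representations of `c` as a left quotient. -/
lemma card_filter_mem_and_mul_right_mem {ι G : Type*} [Fintype ι] [Group G] [DecidableEq G]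
    (D : Finset G) (e : ι ≃ G) (c : G) :
    (Finset.univ.filter (fun b => e b ∈ D ∧ e b * c ∈ D)).card =
      ((D ×ˢ D).filter (fun p => p.1⁻¹ * p.2 = c)).card := by
  refine Finset.card_nbij' (fun b => (e b, e b * c)) (fun p => e.symm p.1) ?_ ?_ ?_ ?_
  · intro b hb; simpa using hb
  · rintro ⟨p, q⟩ hp
    simp only [Finset.coe_filter, Finset.mem_product, Set.mem_ofPred_eq] at hp
    obtain ⟨hp, rfl⟩ := hp
    simpa using hp
  · intro b _; simp
  · rintro ⟨p, q⟩ hp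
    simp only [Finset.coe_filter, Finset.mem_product, Set.mem_ofPred_eq] at hp
    obtain ⟨hp, rfl⟩ := hp
    simp


/-- Theorem 3.1 of the paper. Let `D` be a `(v,k,λ)` difference set in a
finite group `G` with a fixed enumeration `g : Fin v ≃ G`. Then the `n`-cube
`C(i) = [g(i₁)⋯g(iₙ) ∈ D]` is an `n`-dimensional cube of symmetric `(v,k,λ)` designs:
every slice `M` satisfies `M·Mᵀ = (k−λ)·I + λ·J`. -/
theorem difference_cube_is_cube_of_designs
    (v k l n : ℕ) (hn : 2 ≤ n) (G : Type*) [Group G] [Fintype G] [DecidableEq G]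
    (hv : Fintype.card G = v) (g : Fin v ≃ G) (D : Finset G) (hk : D.card = k)
    (hdiff : ∀ h : G, h ≠ 1 →
      ((D ×ˢ D).filter (fun p => p.1⁻¹ * p.2 = h)).card = l)
    (C : (Fin n → Fin v) → ℤ)
    (hC : ∀ i, C i = if (List.ofFn (fun t => g (i t))).prod ∈ D then 1 else 0)
    (x y : Fin n) (hxy : x ≠ y) (fixed : Fin n → Fin v)
    (M : Matrix (Fin v) (Fin v) ℤ)
    (hM : ∀ a b, M a b = C (fun t => if t = x then a else if t = y then b else fixed t)) :
    M * M.transpose = ((k : ℤ) - (l : ℤ)) • 1 + (l : ℤ) • Matrix.of (fun _ _ => 1) := by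
  have hM' : ∀ a b, M a b =
      if (List.ofFn (fun t => if t = x then g a else if t = y then g b else g (fixed t))).prod ∈ D
        then 1 else 0 := by
    intro a b
    simp only [hM, hC, apply_ite g]
  have diag : ∀ (e : Fin v ≃ G), (Finset.univ.filter (fun b => e b ∈ D)).card = k := by
    intro e
    rw [← hk]
    exact Finset.card_nbij' e e.symm (fun b hb => by simpa using hb)
      (fun d hd => by simpa using hd) (fun _ _ => by simp) (fun _ _ => by simp)
  have entry : ∀ a a', (M * M.transpose) a a' = if a = a' then (k : ℤ) else l := by
    intro a a'
    rcases lt_or_gt_of_ne hxy with hlt | hlt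
    · obtain ⟨p, q, r, h⟩ := exists_prod_ofFn_eq_of_lt (fun t => g (fixed t)) x y hlt
      let e : Fin v ≃ G :=
        g.trans ((Equiv.mulLeft (p * g a' * q)).trans (Equiv.mulRight r))
      have he : ∀ b, p * g a' * q * g b * r = e b := fun _ => rfl
      have he' : ∀ b, p * g a * q * g b * r = p * g a * (g a')⁻¹ * p⁻¹ * e b := by
        intro b
        rw [← he]
        group
      have hsum : (M * M.transpose) a a' = ((Finset.univ.filter
          (fun b => p * g a * (g a')⁻¹ * p⁻¹ * e b ∈ D ∧ e b ∈ D)).card : ℤ) := by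
        simp only [Matrix.mul_apply, Matrix.transpose_apply, hM', h, he, he', Finset.card_filter,
          Nat.cast_sum, Nat.cast_ite, Nat.cast_one, Nat.cast_zero, ite_and, ite_mul, one_mul,
          zero_mul]
      rw [hsum]
      split_ifs with haa
      · subst haa
        simp [diag]
      · rw [card_filter_mem_and_mul_left_mem,
          card_right_quotient_of_card_left_quotient D l hdiff]
        rw [Ne, mul_inv_eq_one, mul_assoc, mul_eq_left, mul_inv_eq_one]
        exact fun hg => haa (g.injective hg)
    · obtain ⟨p, q, r, h⟩ := exists_prod_ofFn_eq_of_lt (fun t => g (fixed t)) y x hlt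
      have h' : ∀ a b, (List.ofFn (fun t => if t = x then g a else if t = y then g b
          else g (fixed t))).prod = p * g b * q * g a * r := by
        intro a b
        rw [← h]
        congr 2
        funext t
        grind
      let e : Fin v ≃ G :=
        g.trans ((Equiv.mulLeft p).trans (Equiv.mulRight (q * g a * r)))
      have he : ∀ b, p * g b * q * g a * r = e b := by
        intro b
        simp [e, mul_assoc]
      have he' : ∀ b, p * g b * q * g a' * r = e b * (r⁻¹ * ((g a)⁻¹ * g a') * r) := by
        intro b
        rw [← he]
        group
      have hsum : (M * M.transpose) a a' = ((Finset.univ.filter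
          (fun b => e b ∈ D ∧ e b * (r⁻¹ * ((g a)⁻¹ * g a') * r) ∈ D)).card : ℤ) := by
        simp only [Matrix.mul_apply, Matrix.transpose_apply, hM', h', he, he', Finset.card_filter,
          Nat.cast_sum, Nat.cast_ite, Nat.cast_one, Nat.cast_zero, ite_and, ite_mul, one_mul,
          zero_mul]
      rw [hsum]
      split_ifs with haa
      · subst haa
        simp [diag]
      · rw [card_filter_mem_and_mul_right_mem, hdiff]
        intro hc
        rw [mul_assoc, inv_mul_eq_one, eq_comm, mul_eq_right, inv_mul_eq_one] at hc
        exact haa (g.injective hc)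
  ext a a'
  rw [entry, Matrix.add_apply, Matrix.smul_apply, Matrix.smul_apply, Matrix.one_apply]
  by_cases haa : a = a' <;> simp [haa]
end

section
/- Let G be a finite group of order v, let D ⊆ G be a (v,k,λ) difference set, and let C(i) = [g(i₁)·⋯·g(iₙ) ∈ D] be the associated n-dimensional difference cube (n ≥ 2, g : Fin v → G a bijection). Then every slice of C is an incidence matrix of the development of D or of its dual, up to row and column permutations: for every slice M of C there exist bijections σ, τ : Fin v → Fin v such that either M(a,b) = [g(σ a) ∈ g(τ b)•D] for all a,b, or M(a,b) = [g(σ b) ∈ g(τ a)•D] for all a,b. -/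
open Pointwise

/-- An ordered product, viewed as a function of its entries at positions `x < y`. -/
theorem exists_prod_ofFn_ite_ite_eq {M : Type*} [Monoid M] {n : ℕ} {x y : Fin n} (hxy : x < y)
    (f : Fin n → M) :
    ∃ p q r : M, ∀ a b : M,
      (List.ofFn (fun t => if t = x then a else if t = y then b else f t)).prod =
        p * a * q * b * r := by
  have hlt : x.val < y.val := hxy
  refine ⟨((List.ofFn f).take x).prod, (((List.ofFn f).take y).drop (x + 1)).prod,
    ((List.ofFn f).drop (y + 1)).prod, fun a b => ?_⟩
  have hset : List.ofFn (fun t => if t = x then a else if t = y then b else f t) =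
      ((List.ofFn f).set x a).set y b := by
    apply List.ext_getElem
    · simp
    · intro i h₁ h₂
      simp only [List.getElem_ofFn, List.getElem_set, Fin.ext_iff]
      grind
  rw [hset, List.prod_set, List.take_set, List.prod_set, List.drop_set_of_lt (by omega),
    List.take_take, min_eq_left hlt.le]
  simp [hlt, mul_assoc]

/-- A two-variable product in a group is translate membership after permuting each variable. -/
theorem exists_perm_mem_smul_iff {ι G : Type*} [Group G] [DecidableEq G] (g : ι ≃ G)
    (D : Finset G) (p q r : G) :
    ∃ σ τ : Equiv.Perm ι, ∀ a b : ι,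
      p * g a * q * g b * r ∈ D ↔ g (σ b) ∈ g (τ a) • D := by
  refine ⟨(g.trans (Equiv.mulRight r)).trans g.symm,
    (g.trans (((Equiv.mulLeft p).trans (Equiv.mulRight q)).trans (Equiv.inv G))).trans g.symm,
    fun a b => ?_⟩
  simp [← Finset.inv_smul_mem_iff, mul_assoc]

/-- Every slice of the `n`-dimensional difference cube
`C(i) = [g(i₁)⋯g(iₙ) ∈ D]` is, up to row and column permutations, an incidence matrix of the
development of `D` or of its dual. -/
theorem difference_cube_slices_are_development
    (v k l n : ℕ) (hn : 2 ≤ n) (G : Type*) [Group G] [Fintype G] [DecidableEq G]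
    (hv : Fintype.card G = v) (g : Fin v ≃ G) (D : Finset G) (hk : D.card = k)
    (hdiff : ∀ h : G, h ≠ 1 →
      ((D ×ˢ D).filter (fun p => p.1⁻¹ * p.2 = h)).card = l)
    (C : (Fin n → Fin v) → ℤ)
    (hC : ∀ i, C i = if (List.ofFn (fun t => g (i t))).prod ∈ D then 1 else 0) :
    ∀ x y : Fin n, x ≠ y → ∀ fixed : Fin n → Fin v,
      ∃ σ τ : Equiv.Perm (Fin v),
        (∀ a b : Fin v,
          C (fun t => if t = x then a else if t = y then b else fixed t) =
            if g (σ a) ∈ (g (τ b)) • D then 1 else 0) ∨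
        (∀ a b : Fin v,
          C (fun t => if t = x then a else if t = y then b else fixed t) =
            if g (σ b) ∈ (g (τ a)) • D then 1 else 0) := by
  intro x y hxy fixed
  rcases lt_or_gt_of_ne hxy with h | h
  · obtain ⟨p, q, r, hpqr⟩ := exists_prod_ofFn_ite_ite_eq h (fun t => g (fixed t))
    obtain ⟨σ, τ, hστ⟩ := exists_perm_mem_smul_iff g D p q r
    refine ⟨σ, τ, Or.inr fun a b => ?_⟩
    simp only [hC, apply_ite g, hpqr, hστ]
  · obtain ⟨p, q, r, hpqr⟩ := exists_prod_ofFn_ite_ite_eq h (fun t => g (fixed t))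
    obtain ⟨σ, τ, hστ⟩ := exists_perm_mem_smul_iff g D p q r
    refine ⟨σ, τ, Or.inl fun a b => ?_⟩
    have hswap : (fun t => g (if t = x then a else if t = y then b else fixed t)) =
        fun t => if t = y then g b else if t = x then g a else g (fixed t) := by
      funext t
      grind
    simp only [hC, hswap, hpqr, hστ]
end

section
/- Let G be a finite group of order v, D ⊆ G a (v,k,λ) difference set, and n ≥ 2. For a tuple (a₁,…,a_{n−1}) ∈ G^{n−1}, set a₀ = aₙ = 1 and define bijections α₁,…,αₙ : G → G by α_j(x) = a_{j−1}·x·a_j⁻¹. Then the map sending (a₁,…,a_{n−1}) to (α₁,…,αₙ) is an injective group homomorphism from G^{n−1} into the n-fold direct product of the permutation group of G, and its image fixes the difference cube: [α₁(x₁)·α₂(x₂)·⋯·αₙ(xₙ) ∈ D] = [x₁·x₂·⋯·xₙ ∈ D] for all x₁,…,xₙ ∈ G. -/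
/-- The twisted factors `c j * x j * (c (j + 1))⁻¹` have a telescoping product. -/
theorem List.prod_ofFn_mul_mul_inv {G : Type*} [Group G] (n : ℕ) (c : ℕ → G) (x : Fin n → G) :
    (List.ofFn (fun j : Fin n => c (j : ℕ) * x j * (c ((j : ℕ) + 1))⁻¹)).prod =
      c 0 * (List.ofFn x).prod * (c n)⁻¹ := by
  induction n generalizing c with
  | zero => simp
  | succ m ih =>
    have h := ih (fun t => c (t + 1)) (fun j => x j.succ)
    simp only [List.ofFn_succ, List.prod_cons, Fin.val_zero, Fin.val_succ, zero_add] at h ⊢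
    rw [h]
    group


/-- For a `(v,k,λ)` difference set `D` in a finite group `G` and `n ≥ 2`,
extending a tuple `(a₁,…,a_{n−1}) ∈ G^{n−1}` by `a₀ = aₙ = 1` and letting
`α_j(x) = a_{j−1}·x·a_j⁻¹`, the map `(a₁,…,a_{n−1}) ↦ (α₁,…,αₙ)` is an injective group
homomorphism from `G^{n−1}` into the `n`-fold direct product of the permutation group of `G`,
and its image fixes the difference cube `C(x₁,…,xₙ) = [x₁⋯xₙ ∈ D]`. -/
theorem translation_autotopies_of_difference_cube
    (v k l n : ℕ) (hn : 2 ≤ n) (G : Type*) [Group G] [Fintype G] [DecidableEq G]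
    (hv : Fintype.card G = v) (D : Finset G) (hk : D.card = k)
    (hdiff : ∀ h : G, h ≠ 1 →
      ((D ×ˢ D).filter (fun p => p.1⁻¹ * p.2 = h)).card = l)
    (b : (Fin (n - 1) → G) → ℕ → G)
    (hb : ∀ (a : Fin (n - 1) → G) (t : ℕ),
      b a t = if h : 0 < t ∧ t < n then a ⟨t - 1, by omega⟩ else 1)
    (Φ : (Fin (n - 1) → G) → (Fin n → Equiv.Perm G))
    (hΦ : ∀ (a : Fin (n - 1) → G) (j : Fin n) (x : G),
      Φ a j x = b a (j : ℕ) * x * (b a ((j : ℕ) + 1))⁻¹) :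
    (∀ a a' : Fin (n - 1) → G, Φ (a * a') = Φ a * Φ a') ∧
    Function.Injective Φ ∧
    (∀ (a : Fin (n - 1) → G) (x : Fin n → G),
      (List.ofFn (fun j => Φ a j (x j))).prod ∈ D ↔ (List.ofFn x).prod ∈ D) := by
  have b_zero (a) : b a 0 = 1 := by simp [hb]
  have b_last (a) : b a n = 1 := by simp [hb]
  have b_mul (a a' t) : b (a * a') t = b a t * b a' t := by
    simp only [hb]
    split_ifs <;> simp
  refine ⟨fun a a' => ?_, fun a a' h => ?_, fun a x => ?_⟩
  · ext j x
    simp only [Pi.mul_apply, Equiv.Perm.mul_apply, hΦ, b_mul]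
    group
  · have b_eq (t : ℕ) (ht : t ≤ n) : b a t = b a' t := by
      induction t with
      | zero => rw [b_zero, b_zero]
      | succ t ih =>
        have e : Φ a ⟨t, ht⟩ 1 = Φ a' ⟨t, ht⟩ 1 := by rw [h]
        simpa [hΦ, ih (by omega)] using e
    funext i
    have hi : 0 < (i : ℕ) + 1 ∧ (i : ℕ) + 1 < n := by omega
    simpa [hb, hi.2] using b_eq (i + 1) hi.2.le
  · simp only [hΦ]
    rw [List.prod_ofFn_mul_mul_inv n (b a) x, b_zero, b_last]
    simp
end

section
/- Let G be a finite group of order v, D ⊆ G a (v,k,λ) difference set, and n ≥ 2. Let Mult(D) be the group of multipliers of D, i.e. the subgroup of Aut(G) consisting of automorphisms φ with φ(D) = a•D for some a ∈ G. Then the autotopy group of the n-dimensional difference cube C(x₁,…,xₙ) = [x₁·⋯·xₙ ∈ D], namely the stabilizer of C in the direct product of n copies of the permutation group of G acting by permuting each index independently, contains a subgroup isomorphic to the semidirect product of G^{n−1} by Mult(D), where Mult(D) acts on G^{n−1} componentwise. -/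
open Pointwise

/-- The group of multipliers of a subset `D` of a finite group `G`: automorphisms `φ` of `G`
with `φ(D) = a • D` for some `a ∈ G`. -/
def multGroup {G : Type*} [Group G] [Fintype G] [DecidableEq G] (D : Finset G) :
    Subgroup (MulAut G) where
  carrier := {φ | ∃ a : G, D.image φ = a • D}
  one_mem' := ⟨1, by simp⟩
  mul_mem' := by
    rintro φ ψ ⟨a, ha⟩ ⟨c, hc⟩
    refine ⟨φ c * a, ?_⟩
    have h1 : D.image ⇑(φ * ψ) = (D.image ⇑ψ).image ⇑φ := by
      simp [Finset.image_image]
    rw [h1, hc, Finset.image_smul_distrib, ha, smul_smul]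
  inv_mem' := by
    rintro φ ⟨a, ha⟩
    refine ⟨(φ⁻¹ a)⁻¹, ?_⟩
    have h2 : (D.image ⇑φ).image ⇑φ⁻¹ = D := by
      rw [Finset.image_image]
      have h : ⇑φ⁻¹ ∘ ⇑φ = id := by funext x; simp
      simp [h]
    rw [ha, Finset.image_smul_distrib] at h2
    rw [eq_inv_smul_iff]
    exact h2

section DifferenceSet

variable {G : Type*} [Group G] [DecidableEq G]

/-- The number of representations of `h` as `d₁⁻¹ * d₂` with `d₁, d₂ ∈ D`. -/
def leftDiffCount (D : Finset G) (h : G) : ℤ :=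
  ((D ×ˢ D).filter (fun p => p.1⁻¹ * p.2 = h)).card

/-- The number of representations of `h` as `d₁ * d₂⁻¹` with `d₁, d₂ ∈ D`. -/
def rightDiffCount (D : Finset G) (h : G) : ℤ :=
  ((D ×ˢ D).filter (fun p => p.1 * p.2⁻¹ = h)).card

lemma leftDiffCount_eq (D : Finset G) (h : G) :
    leftDiffCount D h = (D.filter (fun d => d * h ∈ D)).card := by
  unfold leftDiffCount
  congr 1
  refine Finset.card_nbij' (fun p => p.1) (fun d => (d, d * h)) ?_ ?_ ?_ ?_
  · rintro ⟨a, b⟩ hp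
    simp only [Finset.coe_filter, Finset.mem_product, Set.mem_ofPred_eq] at hp ⊢
    obtain ⟨⟨ha, hb⟩, rfl⟩ := hp
    simpa [ha] using hb
  · intro d hd
    simpa using hd
  · rintro ⟨a, b⟩ hp
    simp only [Finset.coe_filter, Finset.mem_product, Set.mem_ofPred_eq] at hp ⊢
    obtain ⟨⟨ha, hb⟩, rfl⟩ := hp
    simp
  · intro d hd
    rfl

lemma rightDiffCount_eq (D : Finset G) (h : G) :
    rightDiffCount D h = (D.filter (fun d => h * d ∈ D)).card := by
  unfold rightDiffCount
  congr 1
  refine Finset.card_nbij' (fun p => p.2) (fun d => (h * d, d)) ?_ ?_ ?_ ?_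
  · rintro ⟨a, b⟩ hp
    simp only [Finset.coe_filter, Finset.mem_product, Set.mem_ofPred_eq] at hp ⊢
    obtain ⟨⟨ha, hb⟩, rfl⟩ := hp
    simpa [hb] using ha
  · intro d hd
    simpa [and_comm] using hd
  · rintro ⟨a, b⟩ hp
    simp only [Finset.coe_filter, Finset.mem_product, Set.mem_ofPred_eq] at hp ⊢
    obtain ⟨⟨ha, hb⟩, rfl⟩ := hp
    simp
  · intro d hd
    rfl

variable [Fintype G]

lemma sum_card_fiber {α β : Type*} [Fintype β] [DecidableEq β] (S : Finset α) (f : α → β) :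
    ∑ b, ((S.filter (fun p => f p = b)).card : ℤ) = S.card := by
  exact_mod_cast (Finset.card_eq_sum_card_fiberwise (f := f) (s := S) (t := Finset.univ)
    (by simp)).symm

lemma sum_card_fiber_sq {α β : Type*} [Fintype β] [DecidableEq β] (S : Finset α) (f : α → β) :
    ∑ b, ((S.filter (fun p => f p = b)).card : ℤ) ^ 2 =
      ∑ p ∈ S, ∑ q ∈ S, if f p = f q then 1 else 0 := by
  simp only [Finset.card_filter, Nat.cast_sum, Nat.cast_ite, Nat.cast_one, Nat.cast_zero, sq,
    Finset.sum_mul_sum]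
  rw [Finset.sum_comm]
  refine Finset.sum_congr rfl fun p _ => ?_
  rw [Finset.sum_comm]
  refine Finset.sum_congr rfl fun q _ => ?_
  simp [eq_comm]

lemma sum_leftDiffCount_sq (D : Finset G) :
    ∑ h, leftDiffCount D h ^ 2 = ∑ h, rightDiffCount D h ^ 2 := by
  simp only [leftDiffCount, rightDiffCount]
  rw [sum_card_fiber_sq (D ×ˢ D) (fun p : G × G => p.1⁻¹ * p.2),
    sum_card_fiber_sq (D ×ˢ D) (fun p : G × G => p.1 * p.2⁻¹)]
  simp only [Finset.sum_product]
  refine Finset.sum_congr rfl fun a _ => ?_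
  rw [Finset.sum_comm]
  refine Finset.sum_congr rfl fun b _ => ?_
  refine Finset.sum_congr rfl fun c _ => Finset.sum_congr rfl fun d _ => ?_
  refine if_congr ?_ rfl rfl
  constructor
  · intro h
    have : c = a * (b⁻¹ * d) := by rw [← h]; group
    rw [this]; group
  · intro h
    have : a = c * d⁻¹ * b := by rw [← h]; group
    rw [this]; group

lemma sum_leftDiffCount (D : Finset G) :
    ∑ h, leftDiffCount D h = ∑ h, rightDiffCount D h := by
  simp only [leftDiffCount, rightDiffCount]
  rw [sum_card_fiber, sum_card_fiber]

/-- A set whose left differences are uniformly distributed has uniformly distributed right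
differences. -/
lemma rightDiffCount_eq_of_leftDiffCount_eq {D : Finset G} {l : ℤ}
    (hD : ∀ h : G, h ≠ 1 → leftDiffCount D h = l) {h : G} (hh : h ≠ 1) :
    rightDiffCount D h = l := by
  have expand : ∀ f : G → ℤ,
      ∑ g, (f g - l) ^ 2 = ∑ g, f g ^ 2 - 2 * l * ∑ g, f g + ∑ _g : G, l ^ 2 := fun f => by
    rw [Finset.mul_sum, ← Finset.sum_sub_distrib, ← Finset.sum_add_distrib]
    exact Finset.sum_congr rfl fun g _ => by ring
  have hsum : ∑ g, (rightDiffCount D g - l) ^ 2 = (leftDiffCount D 1 - l) ^ 2 := by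
    rw [expand, ← sum_leftDiffCount_sq, ← sum_leftDiffCount, ← expand]
    refine Finset.sum_eq_single 1 (fun g _ hg => ?_) (by simp)
    simp [hD g hg]
  have hone : leftDiffCount D 1 = rightDiffCount D 1 := by
    simp [leftDiffCount_eq, rightDiffCount_eq]
  rw [hone, ← Finset.add_sum_erase _ _ (Finset.mem_univ 1), add_eq_left,
    Finset.sum_eq_zero_iff_of_nonneg fun _ _ => sq_nonneg _] at hsum
  have := hsum h (by simpa using hh)
  exact sub_eq_zero.mp (pow_eq_zero_iff two_ne_zero |>.mp this)

/-- A difference set which is neither empty nor the whole group has trivial stabilizer under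
left translation. -/
lemma eq_one_of_smul_eq {D : Finset G} {l : ℤ}
    (hD : ∀ h : G, h ≠ 1 → leftDiffCount D h = l) (hne : D.Nonempty) (huniv : D ≠ Finset.univ)
    {a : G} (ha : a • D = D) : a = 1 := by
  by_contra ha1
  have hal : (D.card : ℤ) = l := by
    rw [← rightDiffCount_eq_of_leftDiffCount_eq hD ha1, rightDiffCount_eq,
      Finset.filter_true_of_mem]
    intro d hd
    have := Finset.smul_mem_smul_finset (a := a) hd
    rwa [ha] at this
  apply huniv
  obtain ⟨d, hd⟩ := hne
  refine Finset.eq_univ_iff_forall.mpr fun x => ?_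
  by_cases hx : d⁻¹ * x = 1
  · rwa [← inv_mul_eq_one.mp hx]
  have hcard := hD _ hx
  rw [← hal, leftDiffCount_eq, Nat.cast_inj, Finset.card_filter_eq_iff] at hcard
  simpa using hcard d hd

/-- The translations attached to the multipliers of a difference set can be chosen so that they
form a crossed homomorphism. -/
lemma exists_multiplier_cocycle {D : Finset G} {l : ℤ}
    (hD : ∀ h : G, h ≠ 1 → leftDiffCount D h = l) :
    ∃ c : multGroup D → G, (∀ φ : multGroup D, D.image (φ : MulAut G) = c φ • D) ∧
      ∀ φ ψ : multGroup D, c (φ * ψ) = (φ : MulAut G) (c ψ) * c φ := by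
  rcases D.eq_empty_or_nonempty with rfl | hne
  · exact ⟨fun _ => 1, by simp, by simp⟩
  by_cases huniv : D = Finset.univ
  · subst huniv
    refine ⟨fun _ => 1, fun φ => ?_, by simp⟩
    rw [one_smul]
    exact Finset.image_univ_of_surjective (φ : MulAut G).surjective
  choose c hc using fun φ : multGroup D => φ.2
  refine ⟨c, hc, fun φ ψ => ?_⟩
  have key : c (φ * ψ) • D = ((φ : MulAut G) (c ψ) * c φ) • D := by
    rw [← hc, mul_smul, ← hc φ, ← Finset.image_smul_distrib, ← hc ψ, Finset.image_image]
    rfl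
  have := eq_one_of_smul_eq hD hne huniv
    (a := ((φ : MulAut G) (c ψ) * c φ)⁻¹ * c (φ * ψ)) (by rw [mul_smul, key, inv_smul_smul])
  exact (inv_mul_eq_one.mp this).symm

end DifferenceSet

lemma prod_ofFn_telescope {G : Type*} [Group G] (φ : MulAut G) {n : ℕ} (u : ℕ → G)
    (x : Fin n → G) :
    (List.ofFn fun j : Fin n => u j * φ (x j) * (u (j + 1))⁻¹).prod =
      u 0 * φ (List.ofFn x).prod * (u n)⁻¹ := by
  induction n generalizing u with
  | zero => simp
  | succ n ih =>
    have := ih (fun i => u (i + 1)) (fun j => x j.succ)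
    simp only [List.ofFn_succ, List.prod_cons, Fin.val_succ, Fin.val_zero, this, map_mul]
    group

/-- The permutation `x ↦ a * φ x * b⁻¹` of a group. -/
def twistedTranslation {G : Type*} [Group G] (a b : G) (φ : MulAut G) : Equiv.Perm G :=
  φ.toEquiv.trans ((Equiv.mulLeft a).trans (Equiv.mulRight b⁻¹))

@[simp]
lemma twistedTranslation_apply {G : Type*} [Group G] (a b : G) (φ : MulAut G) (x : G) :
    twistedTranslation a b φ x = a * φ x * b⁻¹ := rfl

/-- The componentwise action of a group of automorphisms of `G` on `ι → G`. -/
def componentwiseAut (ι : Type*) {G : Type*} [Group G] (H : Subgroup (MulAut G)) :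
    H →* MulAut (ι → G) where
  toFun φ := MulEquiv.piCongrRight fun _ => (φ : MulAut G)
  map_one' := rfl
  map_mul' _ _ := rfl

/-- The sequence `c⁻¹, g₁, …, g_{m}, 1, 1, …`. -/
def paddedSeq {G : Type*} [Group G] {m : ℕ} (c : G) (g : Fin m → G) (i : ℕ) : G :=
  if i = 0 then c⁻¹ else if h : i - 1 < m then g ⟨i - 1, h⟩ else 1

lemma paddedSeq_mul {G : Type*} [Group G] {m : ℕ} (φ : MulAut G) (c d : G) (g h : Fin m → G)
    (i : ℕ) :
    paddedSeq (φ d * c) (fun j => g j * φ (h j)) i = paddedSeq c g i * φ (paddedSeq d h i) := by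
  unfold paddedSeq
  split_ifs <;> simp

/-- Theorem 3.4 of the paper. The autotopy group of the `n`-dimensional
difference cube `C(x₁,…,xₙ) = [x₁⋯xₙ ∈ D]` contains a subgroup isomorphic to the semidirect
product of `G^{n−1}` by the multiplier group `Mult(D)`, acting componentwise: there is an
injective homomorphism from this semidirect product into the `n`-fold direct product of the
permutation group of `G` whose image fixes `C`. -/
theorem difference_cube_autotopy_semidirect_product
    (v k l n : ℕ) (hn : 2 ≤ n) (G : Type*) [Group G] [Fintype G] [DecidableEq G]
    (hv : Fintype.card G = v) (D : Finset G) (hk : D.card = k)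
    (hdiff : ∀ h : G, h ≠ 1 →
      ((D ×ˢ D).filter (fun p => p.1⁻¹ * p.2 = h)).card = l)
    (C : (Fin n → G) → ℤ)
    (hC : ∀ x : Fin n → G, C x = if (List.ofFn x).prod ∈ D then 1 else 0) :
    ∃ ρ : multGroup D →* MulAut (Fin (n - 1) → G),
      (∀ (φ : multGroup D) (x : Fin (n - 1) → G) (j : Fin (n - 1)),
        ρ φ x j = (φ : MulAut G) (x j)) ∧
      ∃ Φ : (Fin (n - 1) → G) ⋊[ρ] multGroup D →* (Fin n → Equiv.Perm G),
        Function.Injective Φ ∧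
        ∀ (s : (Fin (n - 1) → G) ⋊[ρ] multGroup D) (x : Fin n → G),
          C (fun j => Φ s j (x j)) = C x := by
  have hD : ∀ h : G, h ≠ 1 → leftDiffCount D h = (l : ℤ) := fun h hh => by
    rw [leftDiffCount, hdiff h hh]
  obtain ⟨c, hc, hmul⟩ := exists_multiplier_cocycle hD
  refine ⟨componentwiseAut _ _, fun _ _ _ => rfl, ?_⟩
  let u : (Fin (n - 1) → G) ⋊[componentwiseAut _ (multGroup D)] multGroup D → ℕ → G :=
    fun s => paddedSeq (c s.right) s.left
  have hu_mul : ∀ s t i, u (s * t) i = u s i * (s.right : MulAut G) (u t i) := fun s t i => by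
    simp only [u, SemidirectProduct.mul_right, hmul]
    exact paddedSeq_mul _ _ _ _ _ i
  have hu_zero : ∀ s, u s 0 = (c s.right)⁻¹ := fun s => if_pos rfl
  have hu_last : ∀ s, u s n = 1 := fun s => by
    simp [u, paddedSeq, show n ≠ 0 by omega]
  let Φ : (Fin (n - 1) → G) ⋊[componentwiseAut _ (multGroup D)] multGroup D →*
      (Fin n → Equiv.Perm G) :=
    MonoidHom.mk' (fun s j => twistedTranslation (u s j) (u s (j + 1)) s.right) fun s t => by
      funext j
      ext x
      simp [hu_mul, mul_assoc]
  have hΦ : ∀ s j x, Φ s j x = u s j * (s.right : MulAut G) x * (u s (j + 1))⁻¹ :=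
    fun _ _ _ => rfl
  refine ⟨Φ, ?_, fun s x => ?_⟩
  · rw [injective_iff_map_eq_one]
    intro s hs
    have hfix : ∀ (j : Fin n) (x : G), u s j * (s.right : MulAut G) x * (u s (j + 1))⁻¹ = x :=
      fun j x => by rw [← hΦ, hs]; rfl
    have hstep : ∀ j < n, u s j = u s (j + 1) := fun j hj => by
      simpa [mul_inv_eq_one] using hfix ⟨j, hj⟩ 1
    have hone : ∀ j ≤ n, u s j = 1 := fun j hj => by
      induction hj using Nat.decreasingInduction with
      | self => exact hu_last s
      | of_succ k hk ih => rw [hstep k hk, ih]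
    refine SemidirectProduct.ext ?_ ?_
    · funext j
      have := hone (j + 1) (by omega)
      simpa [u, paddedSeq] using this
    · refine Subtype.ext (MulEquiv.ext fun x => ?_)
      have := hfix ⟨0, by omega⟩ x
      rw [hone _ (by simp), hone _ (by simp; omega)] at this
      simpa using this
  · rw [hC, hC]
    refine if_congr ?_ rfl rfl
    simp only [hΦ]
    rw [prod_ofFn_telescope, hu_zero, hu_last, inv_one, mul_one, ← smul_eq_mul,
      Finset.inv_smul_mem_iff, ← hc]
    simp
end

section
/- Let G be a finite group of order v with a bijection g : Fin v → G, and let B : Fin v → Finset G be a family of subsets such that: (i) each B(i) is a (v,k,λ) difference set in G, and (ii) the family is a symmetric (v,k,λ) design, i.e. for any two distinct elements x, y ∈ G the number of indices i with x ∈ B(i) and y ∈ B(i) equals λ. Assume 0 < λ < k < v. Then for every n ≥ 3 the n-cube C(i₁,…,iₙ) = [g(i₂)·g(i₃)·⋯·g(iₙ) ∈ B(i₁)] is an n-dimensional cube of symmetric (v,k,λ) designs: every slice M of C satisfies M·Mᵀ = (k−λ)·I + λ·J. -/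
/-- A product over a list in which one factor varies. -/
theorem exists_prod_ofFn_ite {G : Type*} [Group G] {m : ℕ} (f : Fin m → G) (x : Fin m) :
    ∃ p q : G, ∀ a, (List.ofFn fun t => if t = x then a else f t).prod = p * a * q := by
  induction m with
  | zero => exact x.elim0
  | succ m ih =>
    cases x using Fin.cases with
    | zero =>
      exact ⟨1, (List.ofFn fun t : Fin m => f t.succ).prod, fun a => by
        simp [List.ofFn_succ, Fin.succ_ne_zero]⟩
    | succ x =>
      obtain ⟨p, q, h⟩ := ih (fun t => f t.succ) x
      exact ⟨f 0 * p, q, fun a => by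
        simp [List.ofFn_succ, (Fin.succ_ne_zero x).symm, h, mul_assoc]⟩

/-- A product over a list in which two factors vary. -/
theorem exists_prod_ofFn_ite_ite {G : Type*} [Group G] {m : ℕ} (f : Fin m → G) {x y : Fin m}
    (hxy : x < y) :
    ∃ p q r : G, ∀ a b,
      (List.ofFn fun t => if t = x then a else if t = y then b else f t).prod
        = p * a * q * b * r := by
  induction m with
  | zero => exact x.elim0
  | succ m ih =>
    cases y using Fin.cases with
    | zero => exact absurd hxy (Fin.not_lt_zero x)
    | succ y =>
      cases x using Fin.cases with
      | zero =>
        obtain ⟨p, q, h⟩ := exists_prod_ofFn_ite (fun t => f t.succ) y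
        exact ⟨1, p, q, fun a b => by
          simp [List.ofFn_succ, Fin.succ_ne_zero, h, mul_assoc]⟩
      | succ x =>
        obtain ⟨p, q, r, h⟩ := ih (fun t => f t.succ) (Fin.succ_lt_succ_iff.mp hxy)
        exact ⟨f 0 * p, q, r, fun a b => by
          simp [List.ofFn_succ, (Fin.succ_ne_zero x).symm, (Fin.succ_ne_zero y).symm, h,
            mul_assoc]⟩

/-- A scalar right inverse of an integer matrix is also a scalar left inverse. -/
theorem Matrix.mul_eq_smul_one_comm {ι : Type*} [Fintype ι] [DecidableEq ι]
    {A B : Matrix ι ι ℤ} {c : ℤ} (hc : c ≠ 0) (h : A * B = c • 1) : B * A = c • 1 := by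
  have hdet : A.det ≠ 0 := by
    intro h0
    have := congrArg Matrix.det h
    rw [Matrix.det_mul, h0, zero_mul, Matrix.det_smul, Matrix.det_one, mul_one] at this
    exact pow_ne_zero _ hc this.symm
  have hA : A * (B * A - c • 1) = 0 := by
    rw [mul_sub, ← mul_assoc, h, smul_mul_assoc, one_mul, mul_smul_comm, mul_one, sub_self]
  have := congrArg (A.adjugate * ·) hA
  simp only [← mul_assoc, Matrix.adjugate_mul, mul_zero, smul_mul_assoc, one_mul] at this
  exact sub_eq_zero.mp ((smul_eq_zero.mp this).resolve_left hdet)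

section Incidence

variable {ι : Type*} [Fintype ι] (R : ι → ι → Prop) [DecidableRel R]

/-- The incidence matrix of a relation. -/
def incidenceMatrix : Matrix ι ι ℤ := Matrix.of fun a b => if R a b then 1 else 0

theorem incidenceMatrix_mul_transpose_apply (a b : ι) :
    (incidenceMatrix R * (incidenceMatrix R).transpose) a b
      = (Finset.univ.filter fun c => R a c ∧ R b c).card := by
  simp [incidenceMatrix, Matrix.mul_apply, ← ite_and, Finset.sum_boole, and_comm]

variable {R} [DecidableEq ι] {k l : ℕ}

/-- In a square incidence structure with constant block size and constant pair covering number
`l < k`, every point lies on `k` blocks. -/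
theorem sum_incidenceMatrix_row (hl : 0 < l) (hlk : l < k)
    (hcol : ∀ b, (Finset.univ.filter fun a => R a b).card = k)
    (hpair : ∀ a b, a ≠ b → (Finset.univ.filter fun c => R a c ∧ R b c).card = l) (a : ι) :
    ∑ b, incidenceMatrix R a b = k := by
  have hcol' (b : ι) : ∑ a, incidenceMatrix R a b = k := by
    simp [incidenceMatrix, Finset.sum_boole, hcol]
  have hoff (a b : ι) (hab : a ≠ b) : ∑ c, incidenceMatrix R a c * incidenceMatrix R b c = l := by
    have := incidenceMatrix_mul_transpose_apply R a b
    rw [hpair a b hab] at this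
    simpa [Matrix.mul_apply] using this
  have hsq (a : ι) : ∑ c, incidenceMatrix R a c * incidenceMatrix R a c
      = ∑ c, incidenceMatrix R a c :=
    Finset.sum_congr rfl fun c _ => by simp [incidenceMatrix]
  have hcount (a : ι) : (∑ b, incidenceMatrix R a b) * ((k : ℤ) - 1)
      = ((Fintype.card ι : ℤ) - 1) * l := by
    have h1 : ∑ b, ∑ c, incidenceMatrix R a c * incidenceMatrix R b c
        = (∑ c, incidenceMatrix R a c) * k := by
      rw [Finset.sum_comm, Finset.sum_mul]
      exact Finset.sum_congr rfl fun c _ => by rw [← Finset.mul_sum, hcol']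
    rw [← Finset.add_sum_erase _ _ (Finset.mem_univ a), hsq,
      Finset.sum_congr rfl fun b hb => hoff a b (Finset.ne_of_mem_erase hb).symm] at h1
    simp only [Finset.sum_const, Finset.card_erase_of_mem (Finset.mem_univ a),
      Finset.card_univ, nsmul_eq_mul,
      Nat.cast_sub (Fintype.card_pos_iff.mpr ⟨a⟩ : 1 ≤ Fintype.card ι)] at h1
    push_cast at h1
    linarith
  have hconst (b : ι) : ∑ c, incidenceMatrix R b c = ∑ c, incidenceMatrix R a c :=
    mul_right_cancel₀ (by omega : (k : ℤ) - 1 ≠ 0) ((hcount b).trans (hcount a).symm)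
  have htotal : ∑ b, ∑ c, incidenceMatrix R b c = ∑ _c : ι, (k : ℤ) :=
    Finset.sum_comm.trans (Finset.sum_congr rfl fun c _ => hcol' c)
  rw [Finset.sum_congr rfl fun b _ => hconst b, Finset.sum_const, Finset.sum_const] at htotal
  exact smul_right_injective ℤ
    (by simpa using (Fintype.card_pos_iff.mpr ⟨a⟩).ne' : (Finset.univ : Finset ι).card ≠ 0) htotal

theorem incidenceMatrix_mul_transpose (hl : 0 < l) (hlk : l < k)
    (hcol : ∀ b, (Finset.univ.filter fun a => R a b).card = k)
    (hpair : ∀ a b, a ≠ b → (Finset.univ.filter fun c => R a c ∧ R b c).card = l) :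
    incidenceMatrix R * (incidenceMatrix R).transpose
      = ((k : ℤ) - l) • 1 + (l : ℤ) • Matrix.of (fun _ _ => 1) := by
  ext a b
  rw [incidenceMatrix_mul_transpose_apply, Matrix.add_apply, Matrix.smul_apply,
    Matrix.smul_apply]
  rcases eq_or_ne a b with rfl | hab
  · have := sum_incidenceMatrix_row hl hlk hcol hpair a
    simp only [incidenceMatrix, Matrix.of_apply, Finset.sum_boole] at this
    simp [this]
  · simp [hpair a b hab, hab]

/-- The dual of a symmetric design is a symmetric design. -/
theorem incidenceMatrix_transpose_mul (hl : 0 < l) (hlk : l < k)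
    (hcol : ∀ b, (Finset.univ.filter fun a => R a b).card = k)
    (hpair : ∀ a b, a ≠ b → (Finset.univ.filter fun c => R a c ∧ R b c).card = l) :
    (incidenceMatrix R).transpose * incidenceMatrix R
      = ((k : ℤ) - l) • 1 + (l : ℤ) • Matrix.of (fun _ _ => 1) := by
  set A := incidenceMatrix R with hA
  set J : Matrix ι ι ℤ := Matrix.of (fun _ _ => 1)
  have hAJ : A * J = (k : ℤ) • J := by
    ext a b
    simpa [J, Matrix.mul_apply] using sum_incidenceMatrix_row hl hlk hcol hpair a
  have hJA : J * A = (k : ℤ) • J := by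
    ext a b
    simp [J, hA, Matrix.mul_apply, incidenceMatrix, Finset.sum_boole, hcol]
  have hinv : A * ((k : ℤ) • A.transpose - (l : ℤ) • J) = ((k : ℤ) * (k - l)) • 1 := by
    rw [mul_sub, mul_smul_comm, mul_smul_comm, hAJ,
      incidenceMatrix_mul_transpose hl hlk hcol hpair]
    module
  have hk : (k : ℤ) ≠ 0 := by omega
  have hcomm := Matrix.mul_eq_smul_one_comm (mul_ne_zero hk (by omega)) hinv
  rw [sub_mul, smul_mul_assoc, smul_mul_assoc, hJA, sub_eq_iff_eq_add] at hcomm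
  refine smul_right_injective _ hk (hcomm.trans ?_)
  module

end Incidence

section Slices

variable {v k l : ℕ} {G : Type*} [Group G] [DecidableEq G]

/-- A bijection indexes exactly `D.card` elements of `D`. -/
theorem card_filter_equiv_mem {α : Type*} [DecidableEq α] (e : Fin v ≃ α) (D : Finset α) :
    (Finset.univ.filter fun a => e a ∈ D).card = D.card :=
  Finset.card_bij (fun a _ => e a) (by simp) (fun _ _ _ _ h => e.injective h)
    fun d hd => ⟨e.symm d, by simpa using hd, by simp⟩

theorem card_filter_mul_mul_mem (g : Fin v ≃ G) (D : Finset G) (p q : G) :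
    (Finset.univ.filter fun a => p * g a * q ∈ D).card = D.card :=
  card_filter_equiv_mem ((g.trans (Equiv.mulLeft p)).trans (Equiv.mulRight q)) D

/-- The translates of a difference set meet pairwise in `l` elements. -/
theorem card_filter_mul_mem_and_mul_mem (e : Fin v ≃ G) {D : Finset G}
    (hD : ∀ h : G, h ≠ 1 → ((D ×ˢ D).filter fun p => p.1⁻¹ * p.2 = h).card = l)
    {s t : G} (hst : s ≠ t) :
    (Finset.univ.filter fun c => e c * s ∈ D ∧ e c * t ∈ D).card = l := by
  rw [← hD (s⁻¹ * t) (by rwa [Ne, inv_mul_eq_one])]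
  refine Finset.card_bij (fun c _ => (e c * s, e c * t)) ?_ ?_ ?_
  · intro c hc
    simp only [Finset.mem_filter, Finset.mem_univ, true_and] at hc
    simp [hc, mul_assoc]
  · intro c _ d _ h
    simpa using congrArg Prod.fst h
  · rintro ⟨d, d'⟩ h
    simp only [Finset.mem_filter, Finset.mem_product] at h
    have h2 : d * s⁻¹ * t = d' := by
      rw [mul_assoc, ← h.2, mul_inv_cancel_left]
    exact ⟨e.symm (d * s⁻¹), by simp [h.1, h2], by simp [h2]⟩

theorem card_filter_slice_mem_and_mem (g : Fin v ≃ G) {D : Finset G}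
    (hD : ∀ h : G, h ≠ 1 → ((D ×ˢ D).filter fun p => p.1⁻¹ * p.2 = h).card = l)
    (p q r : G) {a b : Fin v} (hab : a ≠ b) :
    (Finset.univ.filter fun c =>
      p * g c * q * g a * r ∈ D ∧ p * g c * q * g b * r ∈ D).card = l := by
  have := card_filter_mul_mem_and_mul_mem
    ((g.trans (Equiv.mulLeft p)).trans (Equiv.mulRight q)) hD
    (s := g a * r) (t := g b * r) (by simpa using hab)
  simpa [mul_assoc] using this

end Slices

/-- Theorem 4.2 of the paper. Let `G` be a finite group of order `v`,
enumerated by `g : Fin v ≃ G`, and let `B` be a family of `v` blocks forming a symmetric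
`(v,k,λ)` design all of whose blocks are `(v,k,λ)` difference sets in `G`. Then for `n ≥ 3`
the group cube `C(i₁,…,iₙ) = [g(i₂)⋯g(iₙ) ∈ B(i₁)]` is an `n`-dimensional cube of symmetric
`(v,k,λ)` designs: every slice `M` satisfies `M·Mᵀ = (k−λ)·I + λ·J`. -/
theorem group_cube_is_cube_of_designs
    (v k l n : ℕ) (hn : 3 ≤ n) (hl : 0 < l) (hlk : l < k) (hkv : k < v)
    (G : Type*) [Group G] [Fintype G] [DecidableEq G] (hv : Fintype.card G = v)
    (g : Fin v ≃ G) (B : Fin v → Finset G)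
    (hBk : ∀ i, (B i).card = k)
    (hBdiff : ∀ i, ∀ h : G, h ≠ 1 →
      (((B i) ×ˢ (B i)).filter (fun p => p.1⁻¹ * p.2 = h)).card = l)
    (hdesign : ∀ x y : G, x ≠ y →
      (Finset.univ.filter (fun i : Fin v => x ∈ B i ∧ y ∈ B i)).card = l)
    (C : (Fin n → Fin v) → ℤ)
    (hC : ∀ i, C i =
      if (List.ofFn (fun t => g (i t))).tail.prod ∈ B (i ⟨0, by omega⟩) then 1 else 0)
    (x y : Fin n) (hxy : x ≠ y) (fixed : Fin n → Fin v)
    (M : Matrix (Fin v) (Fin v) ℤ)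
    (hM : ∀ a b, M a b = C (fun t => if t = x then a else if t = y then b else fixed t)) :
    M * M.transpose = ((k : ℤ) - (l : ℤ)) • 1 + (l : ℤ) • Matrix.of (fun _ _ => 1) := by
  obtain ⟨m, rfl⟩ : ∃ m, n = m + 1 := ⟨n - 1, by omega⟩
  have htail (i : Fin (m + 1) → Fin v) : C i =
      if (List.ofFn fun t : Fin m => g (i t.succ)).prod ∈ B (i 0) then 1 else 0 := by
    simp [hC, List.ofFn_succ]
  cases x using Fin.cases with
  | zero =>
    cases y using Fin.cases with
    | zero => exact absurd rfl hxy
    | succ y =>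
      obtain ⟨p, q, h⟩ := exists_prod_ofFn_ite (fun t => g (fixed t.succ)) y
      have hMR : M = (incidenceMatrix fun b a => p * g b * q ∈ B a).transpose := by
        ext a b
        simp [hM, htail, incidenceMatrix, Fin.succ_ne_zero, apply_ite g, h]
      rw [hMR, Matrix.transpose_transpose]
      exact incidenceMatrix_transpose_mul hl hlk
        (fun a => by rw [card_filter_mul_mul_mem, hBk])
        fun a b hab => hdesign _ _ (by simpa using hab)
  | succ x =>
    cases y using Fin.cases with
    | zero =>
      obtain ⟨p, q, h⟩ := exists_prod_ofFn_ite (fun t => g (fixed t.succ)) x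
      have hMR : M = incidenceMatrix fun a b => p * g a * q ∈ B b := by
        ext a b
        simp [hM, htail, incidenceMatrix, Fin.succ_ne_zero, (Fin.succ_ne_zero x).symm,
          apply_ite g, h]
      rw [hMR]
      exact incidenceMatrix_mul_transpose hl hlk
        (fun a => by rw [card_filter_mul_mul_mem, hBk])
        fun a b hab => hdesign _ _ (by simpa using hab)
    | succ y =>
      rcases lt_or_gt_of_ne (Fin.succ_injective m |>.ne_iff.mp hxy) with hlt | hlt
      · obtain ⟨p, q, r, h⟩ := exists_prod_ofFn_ite_ite (fun t => g (fixed t.succ)) hlt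
        have hMR : M = (incidenceMatrix fun b a =>
            p * g a * q * g b * r ∈ B (fixed 0)).transpose := by
          ext a b
          simp [hM, htail, incidenceMatrix, (Fin.succ_ne_zero x).symm,
            (Fin.succ_ne_zero y).symm, apply_ite g, h]
        rw [hMR, Matrix.transpose_transpose]
        refine incidenceMatrix_transpose_mul hl hlk (fun a => ?_)
          fun a b hab => card_filter_slice_mem_and_mem g (hBdiff _) p q r hab
        rw [card_filter_mul_mul_mem, hBk]
      · obtain ⟨p, q, r, h⟩ := exists_prod_ofFn_ite_ite (fun t => g (fixed t.succ)) hlt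
        have hMR : M = incidenceMatrix fun a b =>
            p * g b * q * g a * r ∈ B (fixed 0) := by
          ext a b
          have hswap : (fun t => if t = x then g a else if t = y then g b else g (fixed t.succ))
              = fun t => if t = y then g b else if t = x then g a else g (fixed t.succ) := by
            funext t
            split_ifs with h1 h2 <;> first | rfl | exact absurd (h1.symm.trans h2) hlt.ne'
          simp [hM, htail, incidenceMatrix, (Fin.succ_ne_zero x).symm,
            (Fin.succ_ne_zero y).symm, apply_ite g, hswap, h]
        rw [hMR]
        refine incidenceMatrix_mul_transpose hl hlk (fun a => ?_)
          fun a b hab => card_filter_slice_mem_and_mem g (hBdiff _) p q r hab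
        rw [card_filter_mul_mul_mem, hBk]
end

section
/- Let A be a v × v matrix with integer entries all in {0,1} satisfying A·Aᵀ = (k−λ)·I + λ·J, where 0 < λ < k < v, I is the identity matrix and J the all-ones matrix. Then the transposed matrix satisfies the same equation: Aᵀ·A = (k−λ)·I + λ·J. -/
/-- A square matrix over an integral domain with nonzero determinant is left cancellable. -/
theorem Matrix.mul_left_cancel_of_det_ne_zero {m R : Type*} [Fintype m] [DecidableEq m]
    [CommRing R] [IsDomain R] {A X Y : Matrix m m R} (hA : A.det ≠ 0) (h : A * X = A * Y) :
    X = Y := by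
  have h' := congrArg (A.adjugate * ·) h
  simp only [← Matrix.mul_assoc, Matrix.adjugate_mul, Matrix.smul_mul, Matrix.one_mul] at h'
  exact smul_right_injective _ hA h'


/-- If a `{0,1}`-matrix `A` of order `v` satisfies
`A·Aᵀ = (k−λ)·I + λ·J` with `0 < λ < k < v`, then so does its transpose:
`Aᵀ·A = (k−λ)·I + λ·J`. -/
theorem transpose_incidence_matrix_symmetric_design
    (v k l : ℕ) (hl : 0 < l) (hlk : l < k) (hkv : k < v)
    (A : Matrix (Fin v) (Fin v) ℤ) (h01 : ∀ i j, A i j = 0 ∨ A i j = 1)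
    (hA : A * A.transpose = ((k : ℤ) - (l : ℤ)) • 1 + (l : ℤ) • Matrix.of (fun _ _ => 1)) :
    A.transpose * A = ((k : ℤ) - (l : ℤ)) • 1 + (l : ℤ) • Matrix.of (fun _ _ => 1) := by
  set J : Matrix (Fin v) (Fin v) ℤ := Matrix.of (fun _ _ => 1) with hJ
  set n : ℤ := (k : ℤ) - l with hn
  have hn0 : 0 < n := by omega
  have hk0 : (k : ℤ) ≠ 0 := by omega
  have hd : 0 < n + l * v := by positivity
  have hJJ : J * J = (v : ℤ) • J := by
    ext i j; simp [hJ, Matrix.mul_apply]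
  have hJt : J.transpose = J := rfl
  have hAJ : A * J = (k : ℤ) • J := by
    ext i j
    have h := congrFun (congrFun hA i) i
    simp only [Matrix.mul_apply, Matrix.transpose_apply, Matrix.add_apply, Matrix.smul_apply,
      Matrix.one_apply_eq, hJ, Matrix.of_apply, smul_eq_mul, mul_one] at h ⊢
    have hs : ∑ x, A i x = ∑ x, A i x * A i x :=
      Finset.sum_congr rfl fun x _ => by rcases h01 i x with h | h <;> simp [h]
    rw [hs, h, hn]; ring
  have hdet : A.det ≠ 0 := by
    have h : A * (A.transpose * ((n + l * v) • (1 : Matrix (Fin v) (Fin v) ℤ) - (l : ℤ) • J))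
        = (n * (n + l * v)) • 1 := by
      rw [← Matrix.mul_assoc, hA]
      simp only [add_mul, mul_sub, Matrix.smul_mul, Matrix.mul_smul, Matrix.one_mul,
        Matrix.mul_one, hJJ]
      module
    intro h0
    have h' := congrArg Matrix.det h
    rw [Matrix.det_mul, h0, zero_mul, Matrix.det_smul, Matrix.det_one, mul_one] at h'
    exact pow_ne_zero _ (mul_pos hn0 hd).ne' h'.symm
  have hcol : (k : ℤ) • (A.transpose * J) = (n + l * v) • J := by
    apply Matrix.mul_left_cancel_of_det_ne_zero hdet
    rw [Matrix.mul_smul, ← Matrix.mul_assoc, hA, Matrix.mul_smul, hAJ]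
    simp only [add_mul, Matrix.smul_mul, Matrix.one_mul, hJJ]
    module
  have hrow : (k : ℤ) • (J * A) = (n + l * v) • J := by
    have h := congrArg Matrix.transpose hcol
    rwa [Matrix.transpose_smul, Matrix.transpose_smul, Matrix.transpose_mul, hJt,
      Matrix.transpose_transpose] at h
  have hk2 : (k : ℤ) * k = n + l * v := by
    have h := congrArg (· * J) hrow
    simp only [Matrix.smul_mul, Matrix.mul_assoc, hAJ, Matrix.mul_smul, hJJ] at h
    have h' := congrFun (congrFun h ⟨0, by omega⟩) ⟨0, by omega⟩
    simp only [Matrix.smul_apply, hJ, Matrix.of_apply, smul_eq_mul, mul_one, ← mul_assoc] at h'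
    exact mul_right_cancel₀ (by omega) h'
  have hJA : J * A = A * J := by
    rw [← hk2, mul_smul] at hrow
    rw [hAJ]
    exact smul_right_injective _ hk0 hrow
  apply Matrix.mul_left_cancel_of_det_ne_zero hdet
  rw [← Matrix.mul_assoc, hA]
  simp only [add_mul, mul_add, Matrix.smul_mul, Matrix.mul_smul, Matrix.one_mul, Matrix.mul_one,
    hJA]
end

section
/- Let A be a v × v matrix with integer entries all in {0,1} satisfying A·Aᵀ = (k−λ)·I + λ·J, where 0 < λ < k < v, I is the identity matrix and J the all-ones matrix. Then every row sum of A equals k and every column sum of A equals k. -/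
open Matrix in
/-- Applying `n·I + m·J` to a vector. -/
theorem smul_one_add_smul_allOnes_mulVec {ι : Type*} [Fintype ι] [DecidableEq ι]
    (n m : ℤ) (w : ι → ℤ) (i : ι) :
    ((n • (1 : Matrix ι ι ℤ) + m • Matrix.of (fun _ _ => 1)) *ᵥ w) i =
      n * w i + m * ∑ j, w j := by
  rw [Matrix.add_mulVec, Matrix.smul_mulVec, Matrix.smul_mulVec, Matrix.one_mulVec]
  simp [Matrix.mulVec, dotProduct]

theorem det_smul_one_add_smul_allOnes_ne_zero {ι : Type*} [Fintype ι] [DecidableEq ι]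
    {n m : ℤ} (hn : 0 < n) (hm : 0 ≤ m) :
    (n • (1 : Matrix ι ι ℤ) + m • Matrix.of (fun _ _ => 1)).det ≠ 0 := by
  intro hdet
  obtain ⟨w, hw, hMw⟩ := Matrix.exists_mulVec_eq_zero_iff.mpr hdet
  have hcoord (i : ι) : n * w i + m * ∑ j, w j = 0 := by
    rw [← smul_one_add_smul_allOnes_mulVec, hMw, Pi.zero_apply]
  have hsum : (n + Fintype.card ι * m) * ∑ j, w j = 0 := by
    have h := Finset.sum_eq_zero fun i (_ : i ∈ Finset.univ) => hcoord i
    rw [Finset.sum_add_distrib, ← Finset.mul_sum, Finset.sum_const, Finset.card_univ,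
      nsmul_eq_mul] at h
    linarith
  have hzero : ∑ j, w j = 0 := (mul_eq_zero.mp hsum).resolve_left (by positivity)
  refine hw (funext fun i => ?_)
  have h := hcoord i
  rw [hzero, mul_zero, add_zero] at h
  exact (mul_eq_zero.mp h).resolve_left hn.ne'

open Matrix in
/-- If `A·Aᵀ = n·I + m·J` with `n > 0`, `m ≥ 0` and all row sums of `A` equal `k ≠ 0`, then all
column sums of `A` equal `k`. -/
theorem col_sum_eq_of_mul_transpose_eq {ι : Type*} [Fintype ι] [DecidableEq ι]
    {n m k : ℤ} (hn : 0 < n) (hm : 0 ≤ m) (hk : k ≠ 0) {A : Matrix ι ι ℤ}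
    (hA : A * Aᵀ = n • 1 + m • Matrix.of (fun _ _ => 1)) (hrow : ∀ i, ∑ j, A i j = k) (j : ι) :
    ∑ i, A i j = k := by
  have hdet : A.det ≠ 0 := by
    intro h
    apply det_smul_one_add_smul_allOnes_ne_zero (ι := ι) hn hm
    rw [← hA, Matrix.det_mul, h, zero_mul]
  set c : ℤ := n + m * Fintype.card ι with hc
  have hA1 : A *ᵥ 1 = k • 1 := by
    ext i
    simpa [Matrix.mulVec, dotProduct] using hrow i
  have hAAt : A *ᵥ (Aᵀ *ᵥ 1) = c • 1 := by
    ext i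
    rw [Matrix.mulVec_mulVec, hA, smul_one_add_smul_allOnes_mulVec]
    simp [hc]
  have hker : k • (Aᵀ *ᵥ 1) - c • 1 = 0 := by
    apply Matrix.eq_zero_of_mulVec_eq_zero hdet
    rw [Matrix.mulVec_sub, Matrix.mulVec_smul, Matrix.mulVec_smul, hAAt, hA1, smul_comm, sub_self]
  have hcol (j : ι) : k * ∑ i, A i j = c := by
    have h := congrFun hker j
    simp only [Pi.sub_apply, Pi.smul_apply, Pi.zero_apply, Pi.one_apply, smul_eq_mul, mul_one,
      Matrix.mulVec, dotProduct, Matrix.transpose_apply] at h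
    exact sub_eq_zero.mp h
  have htotal : (Fintype.card ι : ℤ) * c = Fintype.card ι * (k * k) := by
    calc (Fintype.card ι : ℤ) * c = ∑ j, k * ∑ i, A i j := by simp [hcol]
      _ = k * ∑ i, ∑ j, A i j := by rw [← Finset.mul_sum, Finset.sum_comm]
      _ = Fintype.card ι * (k * k) := by
        simp only [hrow, Finset.sum_const, Finset.card_univ, nsmul_eq_mul]
        ring
  have hcard : (Fintype.card ι : ℤ) ≠ 0 := by
    exact_mod_cast (Fintype.card_pos_iff.mpr ⟨j⟩).ne'
  exact mul_left_cancel₀ hk ((hcol j).trans (mul_left_cancel₀ hcard htotal))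

/-- If a `{0,1}`-matrix `A` of order `v` satisfies
`A·Aᵀ = (k−λ)·I + λ·J` with `0 < λ < k < v`, then every row sum and every column sum of `A`
equals `k`. -/
theorem incidence_matrix_row_col_sums
    (v k l : ℕ) (hl : 0 < l) (hlk : l < k) (hkv : k < v)
    (A : Matrix (Fin v) (Fin v) ℤ) (h01 : ∀ i j, A i j = 0 ∨ A i j = 1)
    (hA : A * A.transpose = ((k : ℤ) - (l : ℤ)) • 1 + (l : ℤ) • Matrix.of (fun _ _ => 1)) :
    (∀ i, ∑ j, A i j = (k : ℤ)) ∧ (∀ j, ∑ i, A i j = (k : ℤ)) := by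
  have hrow (i : Fin v) : ∑ j, A i j = (k : ℤ) := by
    have hdiag := congrFun (congrFun hA i) i
    have hsq (j : Fin v) : A i j * A i j = A i j := by
      rcases h01 i j with h | h <;> simp [h]
    rw [Matrix.add_apply, Matrix.smul_apply, Matrix.smul_apply, Matrix.one_apply_eq] at hdiag
    simpa [Matrix.mul_apply, hsq] using hdiag
  exact ⟨hrow, col_sum_eq_of_mul_transpose_eq (by omega) (by omega) (by omega) hA hrow⟩
end

section
/- Let C : (Fin n → Fin v) → ℤ be an n-dimensional cube of symmetric (v,k,λ) designs with n ≥ 2 and 0 < λ < k < v, i.e. C takes values in {0,1} and every slice M of C satisfies M·Mᵀ = (k−λ)·I + λ·J. Then the support of C is an orthogonal array of strength n−1 and index k: for every coordinate position x ∈ Fin n and every fixed assignment of values to the other n−1 coordinates, there are exactly k values a ∈ Fin v such that C evaluates to 1 when the coordinate at position x equals a. -/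
/-- The support of an `n`-dimensional cube of symmetric `(v,k,λ)` designs is
an orthogonal array of strength `n−1` and index `k`: for every coordinate position `x` and every
assignment of values to the remaining coordinates, exactly `k` values of the coordinate at
position `x` give the entry `1`. -/
theorem cube_of_designs_is_orthogonal_array
    (v k l n : ℕ) (hn : 2 ≤ n) (hl : 0 < l) (hlk : l < k) (hkv : k < v)
    (C : (Fin n → Fin v) → ℤ) (h01 : ∀ i, C i = 0 ∨ C i = 1)
    (hslice : ∀ x y : Fin n, x ≠ y → ∀ fixed : Fin n → Fin v,
      (Matrix.of fun a b : Fin v =>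
          C (fun t => if t = x then a else if t = y then b else fixed t)) *
        (Matrix.of fun a b : Fin v =>
          C (fun t => if t = x then a else if t = y then b else fixed t)).transpose =
        ((k : ℤ) - (l : ℤ)) • 1 + (l : ℤ) • Matrix.of (fun _ _ => 1)) :
    ∀ (x : Fin n) (fixed : Fin n → Fin v),
      (Finset.univ.filter (fun a : Fin v => C (Function.update fixed x a) = 1)).card = k := by
  intro x fixed
  have : Nontrivial (Fin n) := Fin.nontrivial_iff_two_le.mpr hn
  obtain ⟨y, hy⟩ := exists_ne x
  have hline (b : Fin v) :
      (fun t => if t = y then fixed y else if t = x then b else fixed t) =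
        Function.update fixed x b := by
    funext t
    by_cases hty : t = y
    · subst hty
      simp [hy]
    · simp [hty, Function.update_apply]
  have hdiag := congrFun (congrFun (hslice y x hy fixed) (fixed y)) (fixed y)
  simp only [Matrix.mul_apply, Matrix.transpose_apply, Matrix.of_apply, hline,
    Matrix.add_apply, Matrix.smul_apply, Matrix.one_apply_eq, smul_eq_mul, mul_one,
    sub_add_cancel] at hdiag
  rw [← Nat.cast_inj (R := ℤ), ← hdiag, Finset.card_filter, Nat.cast_sum]
  refine Finset.sum_congr rfl fun a _ => ?_
  rcases h01 (Function.update fixed x a) with h | h <;> simp [h]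
end

section
/- Let L : Fin v → Fin v → Fin v be a function and define the 3-cube C : Fin v → Fin v → Fin v → ℤ by C(i₁,i₂,i₃) = 1 if L(i₁,i₂) = i₃ and C(i₁,i₂,i₃) = 0 otherwise. Then L is a Latin square (i.e. for every fixed i₁ the map i₂ ↦ L(i₁,i₂) is a bijection, and for every fixed i₂ the map i₁ ↦ L(i₁,i₂) is a bijection) if and only if C is a 3-dimensional cube of symmetric (v,1,0) designs, i.e. every slice M of C satisfies M·Mᵀ = I. -/
/-- The `0`-`1` matrix of the graph of a function `f` has orthonormal rows exactly when `f` is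
injective. -/
theorem Matrix.graph_mul_transpose_eq_one_iff {m n : Type*} [Fintype n] [DecidableEq m]
    [DecidableEq n] {f : m → n} {M : Matrix m n ℤ}
    (hM : ∀ a b, M a b = if f a = b then 1 else 0) :
    M * M.transpose = 1 ↔ Function.Injective f := by
  have entry (a b) : (M * M.transpose) a b = if f b = f a then 1 else 0 := by
    simp [Matrix.mul_apply, hM, eq_comm]
  constructor
  · intro h a b hab
    by_contra hne
    have hzero := entry a b
    simp [h, hne, hab] at hzero
  · intro hf
    ext a b
    rw [entry, Matrix.one_apply]
    simp only [hf.eq_iff, eq_comm]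

/-- A square `0`-`1` matrix whose transpose is the graph of an injective function has orthonormal
rows. -/
theorem Matrix.mul_transpose_eq_one_of_transpose_graph {n : Type*} [Fintype n] [DecidableEq n]
    {f : n → n} (hf : Function.Injective f) {M : Matrix n n ℤ}
    (hM : ∀ a b, M a b = if f b = a then 1 else 0) :
    M * M.transpose = 1 := by
  rw [mul_eq_one_comm]
  exact (Matrix.graph_mul_transpose_eq_one_iff (M := M.transpose) fun a b => hM b a).2 hf


/-- A function `L : Fin v → Fin v → Fin v` is a Latin square if and only if
the associated `3`-cube `C(i₁,i₂,i₃) = [L(i₁,i₂) = i₃]` is a `3`-dimensional cube of symmetric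
`(v,1,0)` designs, i.e. every slice `M` satisfies `M·Mᵀ = I`. -/
theorem latin_square_iff_cube_of_designs
    (v : ℕ) (L : Fin v → Fin v → Fin v)
    (C : Fin v → Fin v → Fin v → ℤ)
    (hC : ∀ i₁ i₂ i₃, C i₁ i₂ i₃ = if L i₁ i₂ = i₃ then 1 else 0) :
    ((∀ i₁, Function.Bijective (fun i₂ => L i₁ i₂)) ∧
     (∀ i₂, Function.Bijective (fun i₁ => L i₁ i₂))) ↔
    (∀ x y : Fin 3, x ≠ y → ∀ fixed : Fin 3 → Fin v,
      (Matrix.of fun a b : Fin v =>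
          (fun i : Fin 3 → Fin v => C (i 0) (i 1) (i 2))
            (fun t => if t = x then a else if t = y then b else fixed t)) *
        (Matrix.of fun a b : Fin v =>
          (fun i : Fin 3 → Fin v => C (i 0) (i 1) (i 2))
            (fun t => if t = x then a else if t = y then b else fixed t)).transpose =
        (1 : Matrix (Fin v) (Fin v) ℤ)) := by
  constructor
  · rintro ⟨hrow, hcol⟩
    let e (i : Fin v) : Fin v ≃ Fin v := Equiv.ofBijective (L i) (hrow i)
    have he (i j c) : L i j = c ↔ (e i).symm c = j := by
      rw [Equiv.symm_apply_eq, eq_comm]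
      rfl
    have hinj (c) : Function.Injective fun i => (e i).symm c := by
      intro i i' h
      have h₁ := (he i _ c).2 rfl
      have h₂ := (he i' _ c).2 h.symm
      exact (hcol _).injective (h₁.trans h₂.symm)
    intro x y hxy fixed
    fin_cases x <;> fin_cases y <;> first | exact absurd rfl hxy | skip
    · exact (Matrix.graph_mul_transpose_eq_one_iff fun a b => by
        simp [hC, he]).2 (hinj (fixed 2))
    · exact (Matrix.graph_mul_transpose_eq_one_iff fun a b => by
        simp [hC]).2 (hcol (fixed 1)).injective
    · exact Matrix.mul_transpose_eq_one_of_transpose_graph (hinj (fixed 2)) fun a b => by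
        simp [hC, he]
    · exact (Matrix.graph_mul_transpose_eq_one_iff fun a b => by
        simp [hC]).2 (hrow (fixed 0)).injective
    · exact Matrix.mul_transpose_eq_one_of_transpose_graph (hcol (fixed 1)).injective fun a b => by
        simp [hC]
    · exact Matrix.mul_transpose_eq_one_of_transpose_graph (hrow (fixed 0)).injective fun a b => by
        simp [hC]
  · intro h
    refine ⟨fun i => Finite.injective_iff_bijective.1 ?_, fun j =>
      Finite.injective_iff_bijective.1 ?_⟩
    · exact (Matrix.graph_mul_transpose_eq_one_iff fun a b => by
        simp [hC]).1 (h 1 2 (by decide) fun _ => i)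
    · exact (Matrix.graph_mul_transpose_eq_one_iff fun a b => by
        simp [hC]).1 (h 0 2 (by decide) fun _ => j)
end

section
/- Let m ≥ 1, let G be a finite group of order 4^m, and let D ⊆ G be a (4^m, 2^{m−1}(2^m−1), 2^{m−1}(2^{m−1}−1)) difference set in G. Let K = ZMod 2 × ZMod 2 be the Klein four-group with identity e. Then the subset D' = (Dᶜ × {e}) ∪ (D × ({e}ᶜ)) of the direct product G × K, where Dᶜ and {e}ᶜ denote complements in G and K respectively, is a (4^{m+1}, 2^m(2^{m+1}−1), 2^m(2^m−1)) difference set in G × K. -/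
/-- The `±1`-valued function equal to `-1` exactly on `A`. -/
def signIndicator {H : Type*} [DecidableEq H] (A : Finset H) (x : H) : ℤ :=
  if x ∈ A then -1 else 1

theorem card_filter_inv_mul_eq {H : Type*} [Group H] [Fintype H] [DecidableEq H]
    (A : Finset H) (g : H) :
    ((A ×ˢ A).filter (fun p => p.1⁻¹ * p.2 = g)).card =
      (A.filter (fun x => x * g ∈ A)).card := by
  refine Finset.card_bij (fun p _ => p.1) ?_ ?_ ?_
  · rintro ⟨x, y⟩ h
    simp only [Finset.mem_filter, Finset.mem_product] at h ⊢
    obtain ⟨⟨hx, hy⟩, rfl⟩ := h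
    simpa using ⟨hx, hy⟩
  · rintro ⟨x, y⟩ h ⟨x', y'⟩ h' hxx
    simp only [Finset.mem_filter, Finset.mem_product] at h h' hxx
    subst hxx
    have : y = y' := mul_left_cancel (h.2.trans h'.2.symm)
    rw [this]
  · intro x hx
    simp only [Finset.mem_filter] at hx
    exact ⟨(x, x * g), by simp [hx.1, hx.2], rfl⟩

theorem sum_signIndicator_mul_shift {H : Type*} [Group H] [Fintype H] [DecidableEq H]
    (A : Finset H) (g : H) :
    ∑ x, signIndicator A x * signIndicator A (x * g) =
      (Fintype.card H : ℤ) - 4 * A.card +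
        4 * ((A ×ˢ A).filter (fun p => p.1⁻¹ * p.2 = g)).card := by
  have hpt : ∀ x, signIndicator A x * signIndicator A (x * g) =
      1 - 2 * (if x ∈ A then 1 else 0) - 2 * (if x * g ∈ A then 1 else 0) +
        4 * (if x ∈ A ∧ x * g ∈ A then 1 else 0) := by
    intro x
    unfold signIndicator
    by_cases h₁ : x ∈ A <;> by_cases h₂ : x * g ∈ A <;> simp [h₁, h₂]
  have hA : ∑ x : H, (if x ∈ A then (1 : ℤ) else 0) = A.card := by simp
  have hshift : ∑ x : H, (if x * g ∈ A then (1 : ℤ) else 0) = A.card := by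
    rw [← hA]
    exact Equiv.sum_comp (Equiv.mulRight g) (fun x => if x ∈ A then (1 : ℤ) else 0)
  have hN : ∑ x : H, (if x ∈ A ∧ x * g ∈ A then (1 : ℤ) else 0) =
      (A.filter (fun x => x * g ∈ A)).card := by
    rw [Finset.sum_boole]
    congr 2
    ext x
    simp
  rw [card_filter_inv_mul_eq, Finset.sum_congr rfl fun x _ => hpt x, Finset.sum_add_distrib,
    Finset.sum_sub_distrib, Finset.sum_sub_distrib, ← Finset.mul_sum, ← Finset.mul_sum,
    ← Finset.mul_sum, hA, hshift, hN]
  simp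
  ring

theorem sum_signIndicator_klein_eq_zero (k : Multiplicative (ZMod 2 × ZMod 2)) (hk : k ≠ 1) :
    ∑ y, signIndicator {(1 : Multiplicative (ZMod 2 × ZMod 2))} y *
      signIndicator {(1 : Multiplicative (ZMod 2 × ZMod 2))} (y * k) = 0 := by
  revert k
  decide

/-- Mann's product construction. If `D` is a
`(4^m, 2^{m−1}(2^m−1), 2^{m−1}(2^{m−1}−1))` difference set in a finite group `G` of order `4^m`
and `K` is the Klein four-group with identity `1`, then
`D' = (Dᶜ × {1}) ∪ (D × {1}ᶜ)` is a `(4^{m+1}, 2^m(2^{m+1}−1), 2^m(2^m−1))` difference set in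
`G × K`. -/
theorem mann_product_difference_set
    (m : ℕ) (hm : 1 ≤ m) (G : Type*) [Group G] [Fintype G] [DecidableEq G]
    (hG : Fintype.card G = 4 ^ m) (D : Finset G)
    (hk : D.card = 2 ^ (m - 1) * (2 ^ m - 1))
    (hdiff : ∀ g : G, g ≠ 1 →
      ((D ×ˢ D).filter (fun p => p.1⁻¹ * p.2 = g)).card =
        2 ^ (m - 1) * (2 ^ (m - 1) - 1))
    (D' : Finset (G × Multiplicative (ZMod 2 × ZMod 2)))
    (hD' : D' = Dᶜ ×ˢ ({(1 : Multiplicative (ZMod 2 × ZMod 2))} :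
        Finset (Multiplicative (ZMod 2 × ZMod 2))) ∪
      D ×ˢ ({(1 : Multiplicative (ZMod 2 × ZMod 2))} :
        Finset (Multiplicative (ZMod 2 × ZMod 2)))ᶜ) :
    D'.card = 2 ^ m * (2 ^ (m + 1) - 1) ∧
    ∀ g : G × Multiplicative (ZMod 2 × ZMod 2), g ≠ 1 →
      ((D' ×ˢ D').filter (fun p => p.1⁻¹ * p.2 = g)).card = 2 ^ m * (2 ^ m - 1) := by
  obtain ⟨n, rfl⟩ : ∃ n, m = n + 1 := ⟨m - 1, by omega⟩
  have hcardK : Fintype.card (Multiplicative (ZMod 2 × ZMod 2)) = 4 := by decide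
  have one_le_two_pow : ∀ j : ℕ, 1 ≤ 2 ^ j := fun j => Nat.one_le_two_pow
  simp only [Nat.add_sub_cancel] at hk hdiff
  have hkz : (D.card : ℤ) = 2 ^ n * (2 ^ (n + 1) - 1) := by
    rw [hk]; push_cast [one_le_two_pow]; ring
  have hGz : (Fintype.card G : ℤ) = 4 * (2 ^ n * 2 ^ n) := by
    rw [hG, pow_succ, show (4 : ℕ) = 2 * 2 from rfl, mul_pow]; push_cast; ring
  have hcard : (D'.card : ℤ) = 2 ^ (n + 1) * (2 ^ (n + 2) - 1) := by
    have hdisj : Disjoint (Dᶜ ×ˢ ({1} : Finset (Multiplicative (ZMod 2 × ZMod 2))))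
        (D ×ˢ ({1} : Finset (Multiplicative (ZMod 2 × ZMod 2)))ᶜ) :=
      Finset.disjoint_product.2 (Or.inl disjoint_compl_left)
    rw [hD', Finset.card_union_of_disjoint hdisj, Finset.card_product, Finset.card_product,
      Finset.card_compl, Finset.card_compl, hcardK, Finset.card_singleton]
    push_cast [Finset.card_le_univ D]
    rw [hGz, hkz]
    ring
  have hsign : ∀ p : G × Multiplicative (ZMod 2 × ZMod 2),
      signIndicator D' p = signIndicator D p.1 * signIndicator {1} p.2 := by
    rintro ⟨x, y⟩
    unfold signIndicator
    by_cases h₁ : x ∈ D <;> by_cases h₂ : y = 1 <;> simp [hD', h₁, h₂, eq_comm]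
  refine ⟨?_, ?_⟩
  · zify [one_le_two_pow]
    exact hcard
  · rintro ⟨g, k⟩ hgk
    have hprod : ∑ p, signIndicator D' p * signIndicator D' (p * (g, k)) =
        (∑ x, signIndicator D x * signIndicator D (x * g)) *
          ∑ y, signIndicator {1} y * signIndicator {1} (y * k) := by
      rw [Finset.sum_mul_sum, Fintype.sum_prod_type]
      refine Finset.sum_congr rfl fun x _ => Finset.sum_congr rfl fun y _ => ?_
      rw [hsign, hsign]
      simp only [Prod.mk_mul_mk]
      ring
    have hzero : ∑ p, signIndicator D' p * signIndicator D' (p * (g, k)) = 0 := by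
      rw [hprod]
      by_cases hkone : k = 1
      · have hg : g ≠ 1 := fun h => hgk (by rw [h, hkone]; rfl)
        rw [sum_signIndicator_mul_shift D g, hdiff g hg, hGz, hkz]
        push_cast [one_le_two_pow]
        ring
      · rw [sum_signIndicator_klein_eq_zero k hkone, mul_zero]
    rw [sum_signIndicator_mul_shift, Fintype.card_prod, hcardK, hcard] at hzero
    push_cast at hzero
    rw [hGz] at hzero
    zify [one_le_two_pow]
    have hpow : (2 : ℤ) ^ (n + 2) = 4 * 2 ^ n := by ring
    rw [hpow] at hzero
    rw [pow_succ] at hzero ⊢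
    linarith
end

section
/- Let m ≥ 1 and set v = 4^m, k = 2^{m−1}(2^m−1), λ = 2^{m−1}(2^{m−1}−1). Let A be a v × v matrix with integer entries all in {0,1} satisfying A·Aᵀ = (k−λ)·I + λ·J. Define the 4v × 4v block matrix M, indexed by Fin 4 × Fin v, whose (r,s) block equals J−A when r = s and equals A when r ≠ s. Then M has entries in {0,1} and satisfies M·Mᵀ = (k'−λ')·I + λ'·J with k' = 2^m(2^{m+1}−1) and λ' = 2^m(2^m−1); that is, M is an incidence matrix of a symmetric (4^{m+1}, 2^m(2^{m+1}−1), 2^m(2^m−1)) design. -/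
/-- The contribution of one column of `A` to an inner product of two rows of the block matrix. -/
lemma sum_fin_four_ite_mul_ite (r s : Fin 4) (a b : ℤ) :
    ∑ t : Fin 4, (if r = t then 1 - a else a) * (if s = t then 1 - b else b) =
      if r = s then 1 - a - b + 4 * (a * b) else a + b := by
  fin_cases r <;> fin_cases s <;> simp [Fin.sum_univ_four] <;> ring

/-- A `0`-`1` vector has its sum equal to its sum of squares. -/
lemma sum_eq_sum_mul_self_of_zero_or_one {ι : Type*} [Fintype ι] (f : ι → ℤ)
    (hf : ∀ x, f x = 0 ∨ f x = 1) : ∑ x, f x = ∑ x, f x * f x :=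
  Finset.sum_congr rfl fun x _ => by rcases hf x with h | h <;> simp [h]

/-- the recursive block construction. If `A` is an incidence matrix of a
symmetric `(4^m, 2^{m−1}(2^m−1), 2^{m−1}(2^{m−1}−1))` design, then the `4v × 4v` block matrix
with diagonal blocks `J−A` and off-diagonal blocks `A` is an incidence matrix of a symmetric
`(4^{m+1}, 2^m(2^{m+1}−1), 2^m(2^m−1))` design. -/
theorem block_matrix_menon_design
    (m v k l : ℕ) (hm : 1 ≤ m) (hv : v = 4 ^ m)
    (hk : k = 2 ^ (m - 1) * (2 ^ m - 1)) (hl : l = 2 ^ (m - 1) * (2 ^ (m - 1) - 1))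
    (A : Matrix (Fin v) (Fin v) ℤ) (h01 : ∀ i j, A i j = 0 ∨ A i j = 1)
    (hA : A * A.transpose = ((k : ℤ) - (l : ℤ)) • 1 + (l : ℤ) • Matrix.of (fun _ _ => 1))
    (M : Matrix (Fin 4 × Fin v) (Fin 4 × Fin v) ℤ)
    (hM : ∀ p q : Fin 4 × Fin v,
      M p q = if p.1 = q.1 then 1 - A p.2 q.2 else A p.2 q.2) :
    (∀ p q, M p q = 0 ∨ M p q = 1) ∧
    M * M.transpose =
      ((2 ^ m * (2 ^ (m + 1) - 1) : ℤ) - (2 ^ m * (2 ^ m - 1) : ℤ)) • 1 +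
        (2 ^ m * (2 ^ m - 1) : ℤ) • Matrix.of (fun _ _ => 1) := by
  refine ⟨fun p q => ?_, ?_⟩
  · rw [hM]
    rcases h01 p.2 q.2 with h | h <;> split_ifs <;> simp [h]
  obtain ⟨n, rfl⟩ : ∃ n, m = n + 1 := ⟨m - 1, by omega⟩
  rw [Nat.add_sub_cancel] at hk hl
  have hv' : (v : ℤ) = 4 * (2 ^ n) ^ 2 := by
    rw [hv, ← pow_mul, mul_comm n 2, pow_mul]
    push_cast
    ring
  have hk' : (k : ℤ) = 2 ^ n * (2 * 2 ^ n - 1) := by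
    rw [hk, Nat.cast_mul, Nat.cast_sub Nat.one_le_two_pow]
    push_cast
    ring
  have hl' : (l : ℤ) = 2 ^ n * (2 ^ n - 1) := by
    rw [hl, Nat.cast_mul, Nat.cast_sub Nat.one_le_two_pow]
    push_cast
    ring
  have inner_rows (i j : Fin v) : ∑ x, A i x * A j x = if i = j then (k : ℤ) else l := by
    have h := congrFun (congrFun hA i) j
    simp only [Matrix.mul_apply, Matrix.transpose_apply, Matrix.add_apply, Matrix.smul_apply,
      Matrix.one_apply, Matrix.of_apply, smul_eq_mul] at h
    rw [h]
    split_ifs <;> ring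
  have row_sum (i : Fin v) : ∑ x, A i x = (k : ℤ) := by
    rw [sum_eq_sum_mul_self_of_zero_or_one _ (h01 i), inner_rows, if_pos rfl]
  ext ⟨r, i⟩ ⟨s, j⟩
  simp only [Matrix.mul_apply, Matrix.transpose_apply, Matrix.add_apply, Matrix.smul_apply,
    Matrix.one_apply, Matrix.of_apply, smul_eq_mul, hM, Fintype.sum_prod_type_right,
    sum_fin_four_ite_mul_ite, Prod.mk.injEq]
  by_cases hrs : r = s
  · simp only [hrs, if_true, true_and, Finset.sum_add_distrib, Finset.sum_sub_distrib,
      ← Finset.mul_sum, inner_rows, row_sum, Finset.sum_const, Finset.card_univ,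
      Fintype.card_fin, nsmul_eq_mul, hv', hk', hl']
    split_ifs <;> ring
  · simp only [hrs, if_false, false_and, Finset.sum_add_distrib, row_sum, hk']
    ring
end

section
/- For every m ≥ 2 and every n ≥ 3, set v = 4^m, k = 2^{m−1}(2^m−1), λ = 2^{m−1}(2^{m−1}−1). Then there exist two n-dimensional cubes of symmetric (v,k,λ) designs C₁ and C₂ (functions (Fin n → Fin v) → {0,1} all of whose slices M satisfy M·Mᵀ = (k−λ)·I + λ·J) such that C₁ and C₂ are not paratopic to each other, and neither C₁ nor C₂ is paratopic to any difference cube, i.e. to any cube of the form (i₁,…,iₙ) ↦ [g(i₁)·g(i₂)·⋯·g(iₙ) ∈ D] for a group G of order v, a bijection g : Fin v → G, and a (v,k,λ) difference set D ⊆ G. -/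
/-- `C` is an `n`-dimensional cube of symmetric `(v,k,λ)` designs: a `{0,1}`-valued function on
`(Fin n → Fin v)` all of whose 2-dimensional slices `M` satisfy `M·Mᵀ = (k−λ)·I + λ·J`. -/
def IsCubeOfDesigns (v k l n : ℕ) (C : (Fin n → Fin v) → ℤ) : Prop :=
  (∀ i, C i = 0 ∨ C i = 1) ∧
  ∀ x y : Fin n, x ≠ y → ∀ fixed : Fin n → Fin v,
    (Matrix.of fun a b : Fin v =>
        C (fun t => if t = x then a else if t = y then b else fixed t)) *
      (Matrix.of fun a b : Fin v =>
        C (fun t => if t = x then a else if t = y then b else fixed t)).transpose =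
      ((k : ℤ) - (l : ℤ)) • 1 + (l : ℤ) • Matrix.of (fun _ _ => 1)

/-- Two `n`-cubes of order `v` are paratopic if one is mapped onto the other by permuting each
of the `n` index sets independently combined with permuting the coordinate positions. -/
def Paratopic (v n : ℕ) (C₁ C₂ : (Fin n → Fin v) → ℤ) : Prop :=
  ∃ (γ : Equiv.Perm (Fin n)) (α : Fin n → Equiv.Perm (Fin v)),
    ∀ i, C₂ i = C₁ (fun t => α t (i (γ t)))

/-- `C` is paratopic to a difference cube over the group `G`: a cube of the form
`(i₁,…,iₙ) ↦ [g(i₁)⋯g(iₙ) ∈ D]` for a bijection `g : Fin v ≃ G` and a `(v,k,λ)` difference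
set `D ⊆ G`. -/
def IsDifferenceCubeOver (v k l n : ℕ) (G : Type) [Group G] [Fintype G] [DecidableEq G]
    (C : (Fin n → Fin v) → ℤ) : Prop :=
  Fintype.card G = v ∧
  ∃ (g : Fin v ≃ G) (D : Finset G),
    D.card = k ∧
    (∀ h : G, h ≠ 1 → ((D ×ˢ D).filter (fun p => p.1⁻¹ * p.2 = h)).card = l) ∧
    Paratopic v n C (fun i => if (List.ofFn (fun t => g (i t))).prod ∈ D then 1 else 0)

/-- `C` is a difference cube: it is paratopic to a cube `(i₁,…,iₙ) ↦ [g(i₁)⋯g(iₙ) ∈ D]`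
for some group `G` of order `v` and some `(v,k,λ)` difference set `D ⊆ G`. -/
def IsDifferenceCube (v k l n : ℕ) (C : (Fin n → Fin v) → ℤ) : Prop :=
  ∃ (G : Type) (iG : Group G) (iF : Fintype G) (iD : DecidableEq G),
    @IsDifferenceCubeOver v k l n G iG iF iD C

/-- A direction `t` of a cube is regular if every line in direction `t` can be met by moving a
single other coordinate `s` of an arbitrary position. -/
def IsRegularDirection {v n : ℕ} (C : (Fin n → Fin v) → ℤ) (t : Fin n) : Prop :=
  ∀ s, s ≠ t → ∀ i i' : Fin n → Fin v, ∃ c, ∀ d,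
    C (Function.update (Function.update i s c) t d) = C (Function.update i' t d)

theorem IsRegularDirection.of_paratopic {v n : ℕ} {C₁ C₂ : (Fin n → Fin v) → ℤ}
    {γ : Equiv.Perm (Fin n)} {α : Fin n → Equiv.Perm (Fin v)}
    (h : ∀ i, C₂ i = C₁ (fun t => α t (i (γ t)))) {t : Fin n}
    (ht : IsRegularDirection C₂ (γ t)) : IsRegularDirection C₁ t := by
  intro s hs i i'
  obtain ⟨c, hc⟩ := ht (γ s) (fun e => hs (γ.injective e))
    (fun u => (α (γ.symm u)).symm (i (γ.symm u)))
    (fun u => (α (γ.symm u)).symm (i' (γ.symm u)))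
  refine ⟨α s c, fun d => ?_⟩
  have key := hc ((α t).symm d)
  rw [h, h] at key
  convert key using 2
  · ext1 u
    by_cases hut : u = t
    · subst hut; simp
    · by_cases hus : u = s
      · subst hus; simp [hs]
      · simp [hut, hus]
  · ext1 u
    by_cases hut : u = t
    · subst hut; simp
    · simp [hut]

theorem exists_prod_ofFn_update_eq {G : Type*} [Group G] :
    ∀ {n : ℕ} (f : Fin n → G) (s : Fin n) (p : G),
      ∃ c, (List.ofFn (Function.update f s c)).prod = p
  | 0, _, s, _ => s.elim0
  | n + 1, f, s, p => by
    refine Fin.cases ?_ (fun s => ?_) s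
    · refine ⟨p * (List.ofFn (fun j : Fin n => f j.succ)).prod⁻¹, ?_⟩
      simp [List.ofFn_succ]
    · obtain ⟨c, hc⟩ := exists_prod_ofFn_update_eq (fun j : Fin n => f j.succ) s ((f 0)⁻¹ * p)
      refine ⟨c, ?_⟩
      have : (fun j : Fin n => Function.update f s.succ c j.succ) =
          Function.update (fun j : Fin n => f j.succ) s c := by
        ext j
        by_cases hj : j = s
        · subst hj; simp
        · simp [hj]
      rw [List.ofFn_succ, List.prod_cons, this, hc, Function.update_of_ne (Fin.succ_ne_zero s).symm]
      simp

section DifferenceCube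

variable {v n : ℕ} {G : Type*} [Group G] [DecidableEq G]

theorem isRegularDirection_zero_of_group (g : Fin v ≃ G) (D : Finset G) :
    IsRegularDirection
      (fun i : Fin (n + 1) → Fin v => if (List.ofFn (fun t => g (i t))).prod ∈ D then (1 : ℤ) else 0)
      0 := by
  intro s hs i i'
  obtain ⟨s, rfl⟩ := Fin.exists_succ_eq.2 hs
  obtain ⟨c, hc⟩ := exists_prod_ofFn_update_eq (fun j : Fin n => g (i j.succ)) s
    (List.ofFn (fun j : Fin n => g (i' j.succ))).prod
  refine ⟨g.symm c, fun d => ?_⟩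
  have : (fun j : Fin n => g (Function.update i s.succ (g.symm c) j.succ)) =
      Function.update (fun j : Fin n => g (i j.succ)) s c := by
    ext j
    by_cases hj : j = s
    · subst hj; simp
    · simp [hj]
  simp only [List.ofFn_succ, List.prod_cons, Function.update_self, ne_eq, Fin.succ_ne_zero,
    not_false_eq_true, Function.update_of_ne, this, hc]

theorem isRegularDirection_last_of_group (g : Fin v ≃ G) (D : Finset G) :
    IsRegularDirection
      (fun i : Fin (n + 1) → Fin v => if (List.ofFn (fun t => g (i t))).prod ∈ D then (1 : ℤ) else 0)
      (Fin.last n) := by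
  intro s hs i i'
  obtain ⟨s, rfl⟩ := Fin.exists_castSucc_eq.2 hs
  obtain ⟨c, hc⟩ := exists_prod_ofFn_update_eq (fun j : Fin n => g (i j.castSucc)) s
    (List.ofFn (fun j : Fin n => g (i' j.castSucc))).prod
  refine ⟨g.symm c, fun d => ?_⟩
  have : (fun j : Fin n => g (Function.update i s.castSucc (g.symm c) j.castSucc)) =
      Function.update (fun j : Fin n => g (i j.castSucc)) s c := by
    ext j
    by_cases hj : j = s
    · subst hj; simp
    · simp [hj]
  simp only [List.ofFn_succ', List.concat_eq_append, List.prod_append, Function.update_self, ne_eq,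
    Fin.castSucc_ne_last, not_false_eq_true, Function.update_of_ne, this, hc]

end DifferenceCube

/-- A difference cube of dimension at least two has two distinct regular directions. -/
theorem IsDifferenceCube.exists_isRegularDirection {v k l n : ℕ} (hn : 2 ≤ n)
    {C : (Fin n → Fin v) → ℤ} (h : IsDifferenceCube v k l n C) :
    ∃ s t, s ≠ t ∧ IsRegularDirection C s ∧ IsRegularDirection C t := by
  obtain ⟨n, rfl⟩ : ∃ n', n = n' + 1 := ⟨n - 1, by omega⟩
  obtain ⟨G, _, _, _, -, g, D, -, -, γ, α, hC⟩ := h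
  refine ⟨γ.symm 0, γ.symm (Fin.last n), fun e => ?_, ?_, ?_⟩
  · have := congrArg Fin.val (γ.symm.injective e)
    simp at this
    omega
  · refine .of_paratopic hC ?_
    simpa using isRegularDirection_zero_of_group g D
  · refine .of_paratopic hC ?_
    simpa using isRegularDirection_last_of_group g D

/-- The indicator of the non-zero element of `ZMod 2`, as an integer. -/
def bitInd (a : ZMod 2) : ℤ := if a = 0 then 0 else 1

theorem bitInd_injective : Function.Injective bitInd := by
  unfold Function.Injective bitInd; decide

theorem bitInd_eq_zero_or_one (a : ZMod 2) : bitInd a = 0 ∨ bitInd a = 1 := by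
  unfold bitInd; split_ifs <;> simp

theorem one_sub_two_mul_bitInd_add (a b : ZMod 2) :
    1 - 2 * bitInd (a + b) = (1 - 2 * bitInd a) * (1 - 2 * bitInd b) := by
  revert a b; unfold bitInd; decide

theorem bitVector_add_eq_zero {m : ℕ} {x y : Fin m → ZMod 2} : x + y = 0 ↔ x = y := by
  simp only [funext_iff, Pi.add_apply, Pi.zero_apply, CharTwo.add_eq_zero]

theorem bitVector_add_self {m : ℕ} (x : Fin m → ZMod 2) : x + x = 0 :=
  bitVector_add_eq_zero.2 rfl

section Slices

variable {m : ℕ}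

theorem sum_one_sub_two_mul_bitInd_dotProduct (u : Fin m → ZMod 2) :
    ∑ x : Fin m → ZMod 2, (1 - 2 * bitInd (x ⬝ᵥ u)) = if u = 0 then 2 ^ m else 0 := by
  split_ifs with hu
  · subst hu
    simp [bitInd]
  · obtain ⟨j, hj⟩ := Function.ne_iff.1 hu
    have hj : u j = 1 := by
      have : ∀ a : ZMod 2, a ≠ 0 → a = 1 := by decide
      exact this _ hj
    have key := Equiv.sum_comp (Equiv.addRight (Pi.single j (1 : ZMod 2)))
      (fun x : Fin m → ZMod 2 => 1 - 2 * bitInd (x ⬝ᵥ u))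
    simp only [Equiv.coe_addRight, add_dotProduct, one_sub_two_mul_bitInd_add,
      single_dotProduct, hj, ← Finset.sum_mul] at key
    simp only [bitInd, mul_one, one_ne_zero, if_false] at key
    unfold bitInd
    linarith

variable {L : (Fin m → ZMod 2) → (Fin m → ZMod 2) → (Fin m → ZMod 2)}

theorem sum_slice_row (hL : ∀ p, Function.Injective (L p)) (c : Fin m → ZMod 2)
    (a : (Fin m → ZMod 2) × (Fin m → ZMod 2)) :
    ∑ b : (Fin m → ZMod 2) × (Fin m → ZMod 2),
      (1 - 2 * bitInd ((a.1 + b.1 + c) ⬝ᵥ L a.2 b.2)) = 2 ^ m := by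
  rw [Fintype.sum_prod_type_right]
  have inner : ∀ q : Fin m → ZMod 2,
      ∑ x : Fin m → ZMod 2, (1 - 2 * bitInd ((a.1 + x + c) ⬝ᵥ L a.2 q)) =
        if L a.2 q = 0 then 2 ^ m else 0 := by
    intro q
    rw [← sum_one_sub_two_mul_bitInd_dotProduct, ← Equiv.sum_comp (Equiv.addRight (a.1 + c))]
    refine Finset.sum_congr rfl fun x _ => ?_
    have : a.1 + (x + (a.1 + c)) + c = x + ((a.1 + c) + (a.1 + c)) := by abel
    rw [Equiv.coe_addRight, this, bitVector_add_self, add_zero]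
  obtain ⟨q₀, hq₀⟩ := (Finite.injective_iff_surjective.1 (hL a.2)) 0
  simp only [inner]
  rw [Finset.sum_eq_single q₀ (fun q _ hq => if_neg fun e => hq (hL _ (e.trans hq₀.symm)))
    (by simp), if_pos hq₀]

theorem sum_slice_mul (hL : ∀ p, Function.Injective (L p))
    (hL' : ∀ q, Function.Injective fun p => L p q) (c : Fin m → ZMod 2)
    (a a' : (Fin m → ZMod 2) × (Fin m → ZMod 2)) :
    ∑ b : (Fin m → ZMod 2) × (Fin m → ZMod 2),
      (1 - 2 * bitInd ((a.1 + b.1 + c) ⬝ᵥ L a.2 b.2)) *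
        (1 - 2 * bitInd ((a'.1 + b.1 + c) ⬝ᵥ L a'.2 b.2)) = if a = a' then 4 ^ m else 0 := by
  rw [Fintype.sum_prod_type_right]
  have inner : ∀ q : Fin m → ZMod 2,
      ∑ x : Fin m → ZMod 2, (1 - 2 * bitInd ((a.1 + x + c) ⬝ᵥ L a.2 q)) *
          (1 - 2 * bitInd ((a'.1 + x + c) ⬝ᵥ L a'.2 q)) =
        (1 - 2 * bitInd ((a.1 + c) ⬝ᵥ L a.2 q)) * (1 - 2 * bitInd ((a'.1 + c) ⬝ᵥ L a'.2 q)) *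
          if a.2 = a'.2 then 2 ^ m else 0 := by
    intro q
    have : (a.2 = a'.2) ↔ L a.2 q + L a'.2 q = 0 := by
      rw [bitVector_add_eq_zero, (hL' q).eq_iff]
    simp only [this]
    rw [← sum_one_sub_two_mul_bitInd_dotProduct, Finset.mul_sum]
    refine Finset.sum_congr rfl fun x _ => ?_
    simp only [← one_sub_two_mul_bitInd_add, add_dotProduct, dotProduct_add]
    congr 3
    ring
  simp only [inner]
  rw [← Finset.sum_mul]
  by_cases h : a.2 = a'.2
  · have h2 : ∀ q, (1 - 2 * bitInd ((a.1 + c) ⬝ᵥ L a.2 q)) *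
        (1 - 2 * bitInd ((a'.1 + c) ⬝ᵥ L a'.2 q)) =
        1 - 2 * bitInd (L a.2 q ⬝ᵥ (a.1 + a'.1)) := by
      intro q
      rw [← one_sub_two_mul_bitInd_add, ← h, ← add_dotProduct, dotProduct_comm]
      congr 4
      rw [add_add_add_comm, bitVector_add_self, add_zero]
    simp only [h2]
    rw [(Finite.injective_iff_bijective.1 (hL a.2)).sum_comp
      (fun y => 1 - 2 * bitInd (y ⬝ᵥ (a.1 + a'.1))), sum_one_sub_two_mul_bitInd_dotProduct]
    simp only [bitVector_add_eq_zero, Prod.ext_iff, h, and_true, if_true]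
    split_ifs
    · rw [← mul_pow]; norm_num
    · simp
  · simp [h, Prod.ext_iff]

theorem sum_slice (hm : 1 ≤ m) (hL : ∀ p, Function.Injective (L p))
    (hL' : ∀ q, Function.Injective fun p => L p q) (c : Fin m → ZMod 2)
    (a a' : (Fin m → ZMod 2) × (Fin m → ZMod 2)) :
    ∑ b : (Fin m → ZMod 2) × (Fin m → ZMod 2),
      bitInd ((a.1 + b.1 + c) ⬝ᵥ L a.2 b.2) * bitInd ((a'.1 + b.1 + c) ⬝ᵥ L a'.2 b.2) =
      (((2 ^ (m - 1) * (2 ^ m - 1) : ℕ) : ℤ) - ((2 ^ (m - 1) * (2 ^ (m - 1) - 1) : ℕ) : ℤ)) *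
        (if a = a' then 1 else 0) + ((2 ^ (m - 1) * (2 ^ (m - 1) - 1) : ℕ) : ℤ) := by
  have h1 := sum_slice_row hL c a
  have h2 := sum_slice_row hL c a'
  have h3 := sum_slice_mul hL hL' c a a'
  have h4 : ∑ _b : (Fin m → ZMod 2) × (Fin m → ZMod 2), (1 : ℤ) = 4 ^ m := by
    simp [← mul_pow]
  have h5 : 4 * ∑ b : (Fin m → ZMod 2) × (Fin m → ZMod 2),
      bitInd ((a.1 + b.1 + c) ⬝ᵥ L a.2 b.2) * bitInd ((a'.1 + b.1 + c) ⬝ᵥ L a'.2 b.2) =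
      (if a = a' then 4 ^ m else 0) - 2 ^ m - 2 ^ m + 4 ^ m := by
    rw [← h3, ← h4]
    nth_rewrite 1 [← h1]
    rw [← h2, ← Finset.sum_sub_distrib, ← Finset.sum_sub_distrib, ← Finset.sum_add_distrib,
      Finset.mul_sum]
    refine Finset.sum_congr rfl fun b _ => ?_
    ring
  obtain ⟨m, rfl⟩ : ∃ m', m = m' + 1 := ⟨m - 1, by omega⟩
  have e4 : (4 : ℤ) ^ (m + 1) = 4 * (2 ^ m * 2 ^ m) := by
    rw [← mul_pow, pow_succ]; norm_num [mul_comm]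
  rw [e4, pow_succ] at h5
  push_cast [Nat.cast_sub (Nat.one_le_two_pow)]
  rw [pow_succ]
  split_ifs at h5 ⊢ <;> linarith

end Slices

section Latin

variable {m n : ℕ}

/-- The Latin hypercube `z ↦ ∑ t, z t`, switched by `e` on the positions whose coordinates in `T`
all lie in `{0, e}`. -/
def switchedSum (e : Fin m → ZMod 2) (T : Finset (Fin n)) (z : Fin n → Fin m → ZMod 2) :
    Fin m → ZMod 2 :=
  ∑ t, z t + if ∀ t ∈ T, z t = 0 ∨ z t = e then e else 0

theorem sum_update {V : Type*} [AddCommGroup V] (z : Fin n → V) (s : Fin n) (c : V) :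
    ∑ t, Function.update z s c t = c + ∑ t ∈ Finset.univ \ {s}, z t :=
  Finset.sum_update_of_mem (Finset.mem_univ s) z c

theorem forall_mem_update_iff {V : Type*} (p : V → Prop) (T : Finset (Fin n)) (z : Fin n → V)
    (s : Fin n) (c : V) :
    (∀ t ∈ T, p (Function.update z s c t)) ↔ (s ∈ T → p c) ∧ ∀ t ∈ T, t ≠ s → p (z t) := by
  constructor
  · refine fun h => ⟨fun hs => by simpa using h s hs, fun t ht hts => ?_⟩
    simpa [hts] using h t ht
  · rintro ⟨h1, h2⟩ t ht
    by_cases hts : t = s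
    · subst hts; simpa using h1 ht
    · simpa [hts] using h2 t ht hts

theorem switchedSum_update (e : Fin m → ZMod 2) (T : Finset (Fin n)) (z : Fin n → Fin m → ZMod 2)
    (s : Fin n) (c : Fin m → ZMod 2) :
    switchedSum e T (Function.update z s c) = (c + ∑ t ∈ Finset.univ \ {s}, z t) +
      if (s ∈ T → c = 0 ∨ c = e) ∧ ∀ t ∈ T, t ≠ s → (z t = 0 ∨ z t = e) then e else 0 := by
  simp only [switchedSum, sum_update, forall_mem_update_iff (fun x => x = 0 ∨ x = e)]

theorem switchedSum_update_injective (e : Fin m → ZMod 2) (T : Finset (Fin n))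
    (z : Fin n → Fin m → ZMod 2) (s : Fin n) :
    Function.Injective fun c => switchedSum e T (Function.update z s c) := by
  intro c c' h
  simp only [switchedSum_update] at h
  have inv : ∀ c : Fin m → ZMod 2, (c + e = 0 ∨ c + e = e) ↔ (c = 0 ∨ c = e) := by
    intro c
    rw [bitVector_add_eq_zero, add_eq_right, or_comm]
  have key : ∀ c c' : Fin m → ZMod 2, c = c' + e →
      ((s ∈ T → c = 0 ∨ c = e) ↔ (s ∈ T → c' = 0 ∨ c' = e)) := by
    rintro c c' rfl
    rw [inv]
  split_ifs at h with h1 h2 h2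
  · simpa using h
  · have e1 : c' = c + e := by
      rw [add_zero, add_right_comm] at h
      exact (add_right_cancel h).symm
    exact absurd ⟨(key _ _ e1).2 h1.1, h1.2⟩ h2
  · have e1 : c = c' + e := by
      rw [add_zero, add_right_comm] at h
      exact add_right_cancel h
    exact absurd ⟨(key _ _ e1).2 h2.1, h2.2⟩ h1
  · simpa using h

/-- The cube `((x₁,z₁),…,(xₙ,zₙ)) ↦ (x₁ + ⋯ + xₙ) ⬝ᵥ π(z₁,…,zₙ)` for the Latin hypercube
`π = switchedSum e T`. -/
def switchedCube {v : ℕ} (φ : Fin v ≃ (Fin m → ZMod 2) × (Fin m → ZMod 2)) (e : Fin m → ZMod 2)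
    (T : Finset (Fin n)) (i : Fin n → Fin v) : ℤ :=
  bitInd ((∑ t, (φ (i t)).1) ⬝ᵥ switchedSum e T fun t => (φ (i t)).2)

variable (φ : Fin (4 ^ m) ≃ (Fin m → ZMod 2) × (Fin m → ZMod 2)) (e : Fin m → ZMod 2)
  (T : Finset (Fin n))

theorem switchedCube_isCubeOfDesigns (hm : 1 ≤ m) :
    IsCubeOfDesigns (4 ^ m) (2 ^ (m - 1) * (2 ^ m - 1)) (2 ^ (m - 1) * (2 ^ (m - 1) - 1)) n
      (switchedCube φ e T) := by
  refine ⟨fun i => bitInd_eq_zero_or_one _, fun x y hxy fixed => ?_⟩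
  have upd : ∀ {V : Type} (f : Fin n → V) (p q : V),
      (fun t => if t = x then p else if t = y then q else f t) =
        Function.update (Function.update f y q) x p := by
    intro V f p q
    ext t
    simp only [Function.update_apply]
  set L : (Fin m → ZMod 2) → (Fin m → ZMod 2) → (Fin m → ZMod 2) := fun p q =>
    switchedSum e T (Function.update (Function.update (fun t => (φ (fixed t)).2) y q) x p) with hL
  set c : Fin m → ZMod 2 := ∑ t ∈ (Finset.univ \ {x}) \ {y}, (φ (fixed t)).1 with hc
  have hcube : ∀ a b : Fin (4 ^ m),
      switchedCube φ e T (fun t => if t = x then a else if t = y then b else fixed t) =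
        bitInd (((φ a).1 + (φ b).1 + c) ⬝ᵥ L (φ a).2 (φ b).2) := by
    intro a b
    have h1 : (fun t => (φ (if t = x then a else if t = y then b else fixed t)).1) =
        Function.update (Function.update (fun t => (φ (fixed t)).1) y (φ b).1) x (φ a).1 := by
      rw [← upd]; ext1 t; split_ifs <;> rfl
    have h2 : (fun t => (φ (if t = x then a else if t = y then b else fixed t)).2) =
        Function.update (Function.update (fun t => (φ (fixed t)).2) y (φ b).2) x (φ a).2 := by
      rw [← upd]; ext1 t; split_ifs <;> rfl
    rw [switchedCube, h2, h1, sum_update, Finset.sum_update_of_mem (by simpa using hxy.symm),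
      ← add_assoc]
  have hL1 : ∀ p, Function.Injective (L p) := by
    intro p q q' h
    simp only [hL, Function.update_comm hxy.symm] at h
    exact switchedSum_update_injective _ _ _ _ h
  have hL2 : ∀ q, Function.Injective fun p => L p q :=
    fun q => switchedSum_update_injective _ _ _ _
  ext a a'
  simp only [Matrix.mul_apply, Matrix.transpose_apply, Matrix.of_apply, hcube, Matrix.add_apply,
    Matrix.smul_apply, Matrix.one_apply, smul_eq_mul, mul_one]
  rw [Equiv.sum_comp φ (fun b => bitInd (((φ a).1 + b.1 + c) ⬝ᵥ L (φ a).2 b.2) *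
    bitInd (((φ a').1 + b.1 + c) ⬝ᵥ L (φ a').2 b.2)), sum_slice hm hL1 hL2 c]
  simp only [φ.injective.eq_iff]

theorem comp_update {α V : Type*} (f : α → V) (i : Fin n → α) (s : Fin n) (c : α) :
    (fun t => f (Function.update i s c t)) = Function.update (fun t => f (i t)) s (f c) := by
  ext1 t
  by_cases ht : t = s
  · subst ht; simp
  · simp [ht]

theorem switchedCube_isRegularDirection {t : Fin n} (ht : t ∉ T) :
    IsRegularDirection (switchedCube φ e T) t := by
  intro s hs i i'
  have shift : ∀ (z : Fin n → Fin m → ZMod 2) (d : Fin m → ZMod 2),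
      switchedSum e T (Function.update z t d) =
        switchedSum e T (Function.update z t 0) + d := by
    intro z d
    simp only [switchedSum_update, ht, false_imp_iff]
    abel
  obtain ⟨c₂, hc₂⟩ := Finite.injective_iff_surjective.1
    (switchedSum_update_injective e T (Function.update (fun t => (φ (i t)).2) t 0) s)
    (switchedSum e T (Function.update (fun t => (φ (i' t)).2) t 0))
  simp only [Function.update_comm hs.symm] at hc₂
  refine ⟨φ.symm (∑ u ∈ Finset.univ \ {t}, (φ (i' u)).1 -
    ∑ u ∈ (Finset.univ \ {t}) \ {s}, (φ (i u)).1, c₂), fun d => ?_⟩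
  simp only [switchedCube, comp_update (fun a => (φ a).1), comp_update (fun a => (φ a).2),
    Equiv.apply_symm_apply, sum_update, shift _ (φ d).2, hc₂,
    Finset.sum_update_of_mem (show s ∈ Finset.univ \ {t} by simpa using hs), sub_add_cancel]

theorem switchedCube_not_isRegularDirection (hn : 3 ≤ n) (he : e ≠ 0) {w : Fin m → ZMod 2}
    (hw : w ≠ 0) (hwe : w ≠ e) {t r : Fin n} (ht : t ∈ T) (hr : r ∈ T) (hrt : r ≠ t) :
    ¬ IsRegularDirection (switchedCube φ e T) t := by
  intro h
  obtain ⟨s, hs⟩ : ∃ s, s ∉ ({r, t} : Finset (Fin n)) := by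
    by_contra! hall
    have := Finset.card_le_card (fun s _ => hall s : Finset.univ ⊆ ({r, t} : Finset (Fin n)))
    rw [Finset.card_fin] at this
    exact absurd (this.trans Finset.card_le_two) (by omega)
  simp only [Finset.mem_insert, Finset.mem_singleton, not_or] at hs
  obtain ⟨c, hc⟩ := h s hs.2 (Function.update (fun _ => φ.symm 0) r (φ.symm (0, w)))
    (fun _ => φ.symm 0)
  have key : ∀ x z : Fin m → ZMod 2, (x + (φ c).1) ⬝ᵥ (z + (φ c).2 + w) =
      x ⬝ᵥ (z + if z = 0 ∨ z = e then e else 0) := by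
    intro x z
    have := bitInd_injective (hc (φ.symm (x, z)))
    simp only [comp_update (fun a => (φ a).1), comp_update (fun a => (φ a).2),
      Equiv.apply_symm_apply, Prod.fst_zero, Prod.snd_zero] at this
    have nonspecial : ¬ ((t ∈ T → z = 0 ∨ z = e) ∧ ∀ u ∈ T, u ≠ t →
        (Function.update (Function.update (fun _ => (0 : Fin m → ZMod 2)) r w) s (φ c).2 u = 0 ∨
        Function.update (Function.update (fun _ => (0 : Fin m → ZMod 2)) r w) s (φ c).2 u = e)) := by
      intro hall
      have := hall.2 r hr hrt
      rw [Function.update_of_ne (Ne.symm hs.1), Function.update_self] at this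
      exact this.elim hw hwe
    rw [switchedSum_update, if_neg nonspecial, switchedSum_update] at this
    have hs' : s ∈ Finset.univ \ {t} := by simpa using hs.2
    have hr' : r ∈ (Finset.univ \ {t}) \ {s} := by simpa using ⟨hrt, Ne.symm hs.1⟩
    simpa [sum_update, Finset.sum_update_of_mem hs', Finset.sum_update_of_mem hr', ht,
      add_assoc] using this
  have eq : ∀ z : Fin m → ZMod 2,
      z + (φ c).2 + w = z + if z = 0 ∨ z = e then e else 0 := by
    intro z
    refine dotProduct_eq _ _ fun x => ?_
    have h0 := key 0 z
    rw [zero_add, zero_dotProduct] at h0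
    rw [dotProduct_comm, dotProduct_comm _ x, ← key x z, add_dotProduct, h0, add_zero]
  have h0 := eq 0
  have h1 := eq w
  rw [add_assoc, add_left_cancel_iff] at h0 h1
  rw [h0] at h1
  simp [hw, hwe, he] at h1

end Latin

/-- Theorem 4.4 of the paper. For every `m ≥ 2` and `n ≥ 3` there are two
`n`-dimensional cubes of symmetric `(4^m, 2^{m−1}(2^m−1), 2^{m−1}(2^{m−1}−1))` designs that
are not paratopic to each other and are not paratopic to any difference cube. -/
theorem two_inequivalent_non_difference_cubes
    (m n : ℕ) (hm : 2 ≤ m) (hn : 3 ≤ n) :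
    ∃ C₁ C₂ : (Fin n → Fin (4 ^ m)) → ℤ,
      IsCubeOfDesigns (4 ^ m) (2 ^ (m - 1) * (2 ^ m - 1)) (2 ^ (m - 1) * (2 ^ (m - 1) - 1)) n C₁ ∧
      IsCubeOfDesigns (4 ^ m) (2 ^ (m - 1) * (2 ^ m - 1)) (2 ^ (m - 1) * (2 ^ (m - 1) - 1)) n C₂ ∧
      ¬ Paratopic (4 ^ m) n C₁ C₂ ∧
      ¬ IsDifferenceCube (4 ^ m) (2 ^ (m - 1) * (2 ^ m - 1))
          (2 ^ (m - 1) * (2 ^ (m - 1) - 1)) n C₁ ∧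
      ¬ IsDifferenceCube (4 ^ m) (2 ^ (m - 1) * (2 ^ m - 1))
          (2 ^ (m - 1) * (2 ^ (m - 1) - 1)) n C₂ := by
  have hcard : Fintype.card ((Fin m → ZMod 2) × (Fin m → ZMod 2)) = 4 ^ m := by
    simp [← mul_pow]
  let φ := (Fintype.equivFinOfCardEq hcard).symm
  have h01 : (⟨1, by omega⟩ : Fin m) ≠ ⟨0, by omega⟩ := by simp
  let e : Fin m → ZMod 2 := Pi.single ⟨0, by omega⟩ 1
  let w : Fin m → ZMod 2 := Pi.single ⟨1, by omega⟩ 1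
  have he : e ≠ 0 := by simp [e]
  have hw : w ≠ 0 := by simp [w]
  have hwe : w ≠ e := fun h => by
    simpa [w, e, Pi.single_eq_of_ne h01] using congrFun h ⟨1, by omega⟩
  let p₀ : Fin n := ⟨0, by omega⟩
  let p₁ : Fin n := ⟨1, by omega⟩
  let p₂ : Fin n := ⟨2, by omega⟩
  have h₁ : ∀ t, ¬ IsRegularDirection (switchedCube φ e (Finset.univ : Finset (Fin n))) t := by
    intro t
    obtain ⟨r, hr⟩ : ∃ r : Fin n, r ≠ t := by
      by_cases ht : t = p₀
      · exact ⟨p₁, by simp [ht, p₀, p₁]⟩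
      · exact ⟨p₀, Ne.symm ht⟩
    exact switchedCube_not_isRegularDirection φ e _ hn he hw hwe (Finset.mem_univ t)
      (Finset.mem_univ r) hr
  have h₂ : ∀ t, t ≠ p₂ → ¬ IsRegularDirection (switchedCube φ e ({p₂}ᶜ : Finset (Fin n))) t := by
    intro t ht
    obtain ⟨r, hr, hr'⟩ : ∃ r : Fin n, r ≠ t ∧ r ≠ p₂ := by
      by_cases ht : t = p₀
      · exact ⟨p₁, by simp [ht, p₀, p₁], by simp [p₁, p₂]⟩
      · exact ⟨p₀, Ne.symm ht, by simp [p₀, p₂]⟩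
    exact switchedCube_not_isRegularDirection φ e _ hn he hw hwe (by simpa using ht)
      (by simpa using hr') hr
  refine ⟨switchedCube φ e Finset.univ, switchedCube φ e {p₂}ᶜ,
    switchedCube_isCubeOfDesigns φ e _ (by omega), switchedCube_isCubeOfDesigns φ e _ (by omega),
    ?_, fun h => ?_, fun h => ?_⟩
  · rintro ⟨γ, α, h⟩
    refine h₁ (γ.symm p₂) (.of_paratopic h ?_)
    rw [Equiv.apply_symm_apply]
    exact switchedCube_isRegularDirection φ e _ (by simp)
  · obtain ⟨s, _, -, hs, -⟩ := h.exists_isRegularDirection (by omega)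
    exact h₁ s hs
  · obtain ⟨s, t, hst, hs, ht⟩ := h.exists_isRegularDirection (by omega)
    have hs' : s = p₂ := by_contra fun hne => h₂ s hne hs
    have ht' : t = p₂ := by_contra fun hne => h₂ t hne ht
    exact hst (hs'.trans ht'.symm)
end
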